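/- Let Λ be a finite dimensional basic algebra over an algebraically closed field K with exactly two simple modules, and assume the Gabriel quiver of Λ has no loops. Then Λ is τ-tilting finite if and only if Λ is representation-finite. -/

import Mathlib

/-!
Core definitions for τ-tilting theory of finite dimensional algebras.

Throughout, for an algebra `Λ`, *right* `Λ`-modules are formalized as left modules
over the opposite ring `Λᵐᵒᵖ` (the category `RMod Λ := ModuleCat Λᵐᵒᵖ`).

τ-rigidity is formalized via the standard projective-presentation criterion of
Auslander–Smalø/Adachi–Iyama–Reiten: a finitely generated module `M` is τ-rigid iff it admits
a (finite) projective presentation `P₁ → P₀ → M → 0` such that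
`Hom(P₀, M) → Hom(P₁, M)` is surjective.
-/

noncomputable section

namespace TwoPoint

/-- A module is indecomposable if it is nonzero and admits no nontrivial direct sum
decomposition. -/
def IsIndecModule (R : Type) [Ring R] (M : Type) [AddCommGroup M] [Module R M] : Prop :=
  Nontrivial M ∧ ∀ N₁ N₂ : Submodule R M, IsCompl N₁ N₂ → N₁ = ⊥ ∨ N₂ = ⊥

/-- `M` decomposes as a finite direct sum of indecomposable submodules having exactly `n`
isomorphism classes. -/
def HasIndecClassCount (R : Type) [Ring R] (M : ModuleCat.{0} R) (n : ℕ) : Prop :=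
  ∃ (k : ℕ) (N : Fin k → Submodule R M),
    DirectSum.IsInternal N ∧ (∀ i, IsIndecModule R (N i)) ∧
    ∃ c : Fin k → Fin n, Function.Surjective c ∧
      ∀ i j, (c i = c j ↔ Nonempty ((N i) ≃ₗ[R] (N j)))

/-- `M` is basic: it decomposes as a finite direct sum of pairwise nonisomorphic
indecomposable submodules. -/
def IsBasicModuleCat (R : Type) [Ring R] (M : ModuleCat.{0} R) : Prop :=
  ∃ (k : ℕ) (N : Fin k → Submodule R M),
    DirectSum.IsInternal N ∧ (∀ i, IsIndecModule R (N i)) ∧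
    ∀ i j, i ≠ j → IsEmpty ((N i) ≃ₗ[R] (N j))

/-- τ-rigidity, via the projective presentation criterion: there is a finite projective
presentation `P₁ —f→ P₀ —g→ M → 0` such that `Hom(—, M)` applied to `f` is surjective,
i.e. `Hom_Λ(M, τM) = 0`. -/
def IsTauRigidCat (R : Type) [Ring R] (M : ModuleCat.{0} R) : Prop :=
  Module.Finite R M ∧
  ∃ (P₁ P₀ : ModuleCat.{0} R) (f : P₁ →ₗ[R] P₀) (g : P₀ →ₗ[R] M),
    Module.Finite R P₁ ∧ Module.Projective R P₁ ∧
    Module.Finite R P₀ ∧ Module.Projective R P₀ ∧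
    Function.Surjective g ∧ LinearMap.range f = LinearMap.ker g ∧
    ∀ h : P₁ →ₗ[R] M, ∃ h' : P₀ →ₗ[R] M, h = h'.comp f

/-- Support τ-tilting module, via support τ-tilting pairs `(M, P)` (Adachi–Iyama–Reiten):
`M` is τ-rigid, `P` is finitely generated projective with `Hom(P, M) = 0`, and
`|M| + |P| = |R|` where `|X|` is the number of isomorphism classes of indecomposable
direct summands. -/
def IsSupportTauTiltingCat (R : Type) [Ring R] (M : ModuleCat.{0} R) : Prop :=
  IsTauRigidCat R M ∧
  ∃ (P : ModuleCat.{0} R) (p q r : ℕ),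
    Module.Finite R P ∧ Module.Projective R P ∧
    (∀ f : P →ₗ[R] M, f = 0) ∧
    HasIndecClassCount R M p ∧ HasIndecClassCount R P q ∧
    HasIndecClassCount R (ModuleCat.of R R) r ∧ p + q = r

/-- The category of (finitely generated) right `Λ`-modules, as left `Λᵐᵒᵖ`-modules. -/
abbrev RMod (Λ : Type) [Ring Λ] := ModuleCat.{0} Λᵐᵒᵖ

/-- Basic support τ-tilting right `Λ`-module. -/
def IsBasicSupportTauTilting (Λ : Type) [Ring Λ] (M : RMod Λ) : Prop :=
  IsSupportTauTiltingCat Λᵐᵒᵖ M ∧ IsBasicModuleCat Λᵐᵒᵖ M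

/-- `Λ` is τ-tilting finite: there are only finitely many isomorphism classes of basic
support τ-tilting right `Λ`-modules. -/
def IsTauTiltingFinite (Λ : Type) [Ring Λ] : Prop :=
  ∃ (n : ℕ) (L : Fin n → RMod Λ),
    ∀ M : RMod Λ, IsBasicSupportTauTilting Λ M → ∃ i, Nonempty (M ≃ₗ[Λᵐᵒᵖ] L i)

/-- `Λ` has exactly `n` isomorphism classes of basic support τ-tilting modules. -/
def SupportTauTiltingCount (Λ : Type) [Ring Λ] (n : ℕ) : Prop :=
  ∃ L : Fin n → RMod Λ,
    (∀ i, IsBasicSupportTauTilting Λ (L i)) ∧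
    (∀ i j, Nonempty ((L i) ≃ₗ[Λᵐᵒᵖ] (L j)) → i = j) ∧
    ∀ M : RMod Λ, IsBasicSupportTauTilting Λ M → ∃ i, Nonempty (M ≃ₗ[Λᵐᵒᵖ] L i)

/-- `Fac M ⊆ Fac N`: every factor module of a finite direct sum of copies of `M` is also a
factor module of a finite direct sum of copies of `N`.  This is the partial order on
support τ-tilting modules. -/
def FacLE (Λ : Type) [Ring Λ] (M N : RMod Λ) : Prop :=
  ∀ X : RMod Λ,
    (∃ (k : ℕ) (f : (Fin k → M) →ₗ[Λᵐᵒᵖ] X), Function.Surjective f) →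
    (∃ (k : ℕ) (f : (Fin k → N) →ₗ[Λᵐᵒᵖ] X), Function.Surjective f)

/-- The Hasse quiver of the poset `sτ-tilt Λ` is of type `H_{m,n}`: the poset of
isomorphism classes of basic support τ-tilting modules is isomorphic to the poset
consisting of a greatest element, a least element, and two incomparable chains with `m`
resp. `n` elements in between (hence two directed paths from `Λ` to `0` with `m` resp. `n`
intermediate vertices). -/
def HasseType (Λ : Type) [Ring Λ] (m n : ℕ) : Prop :=
  ∃ T : WithTop (WithBot (Fin m ⊕ Fin n)) → RMod Λ,
    (∀ x, IsBasicSupportTauTilting Λ (T x)) ∧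
    (∀ x y, Nonempty ((T x) ≃ₗ[Λᵐᵒᵖ] (T y)) → x = y) ∧
    (∀ M : RMod Λ, IsBasicSupportTauTilting Λ M → ∃ x, Nonempty (M ≃ₗ[Λᵐᵒᵖ] T x)) ∧
    ∀ x y, x ≤ y ↔ FacLE Λ (T x) (T y)

/-- `Λ` is τ-tilting finite with exactly `N` basic support τ-tilting modules and Hasse
quiver of type `H_{m,n}`. -/
def TauTiltingData (Λ : Type) [Ring Λ] (N m n : ℕ) : Prop :=
  IsTauTiltingFinite Λ ∧ SupportTauTiltingCount Λ N ∧ HasseType Λ m n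

/-- `B` is a factor algebra of `Λ`: there is a surjective `K`-algebra homomorphism
`Λ → B`. -/
def IsFactorAlgebra (K : Type) [CommRing K] (B Λ : Type) [Ring B] [Ring Λ]
    [Algebra K B] [Algebra K Λ] : Prop :=
  ∃ φ : Λ →ₐ[K] B, Function.Surjective φ

/-- `Λ` is a basic algebra: the regular right module decomposes into pairwise
nonisomorphic indecomposables. -/
def IsBasicAlgebra (Λ : Type) [Ring Λ] : Prop :=
  IsBasicModuleCat Λᵐᵒᵖ (ModuleCat.of Λᵐᵒᵖ Λᵐᵒᵖ)

/-- `Λ` is representation-finite: finitely many isomorphism classes of indecomposable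
finitely generated right modules. -/
def IsRepFinite (Λ : Type) [Ring Λ] : Prop :=
  ∃ (n : ℕ) (L : Fin n → RMod Λ), ∀ M : RMod Λ,
    Module.Finite Λᵐᵒᵖ M → IsIndecModule Λᵐᵒᵖ M → ∃ i, Nonempty (M ≃ₗ[Λᵐᵒᵖ] L i)

end TwoPoint

namespace TwoPoint

/-! ### Bound quiver algebras on two-point quivers

A two-point quiver is given by an arrow type `σ` together with source and target functions
`s t : σ → Fin 2`.  The corresponding bound quiver algebra `KQ/I` is presented as the
quotient of the free algebra on the two vertex idempotents and the arrows, by the path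
algebra relations together with the defining relations of `I` (paths are composed from
left to right, so a relation like `αμβ` is the product `α * μ * β`). -/

/-- Generators for the path algebra of a two-point quiver: two vertex idempotents and the
arrows. -/
inductive TPGen (σ : Type) : Type
  | v : Fin 2 → TPGen σ
  | ar : σ → TPGen σ

/-- The vertex idempotent generator. -/
def vtx (K : Type) [Field K] {σ : Type} (i : Fin 2) : FreeAlgebra K (TPGen σ) :=
  FreeAlgebra.ι K (TPGen.v i)

/-- The arrow generator. -/
def arr (K : Type) [Field K] {σ : Type} (a : σ) : FreeAlgebra K (TPGen σ) :=
  FreeAlgebra.ι K (TPGen.ar a)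

/-- The defining relations of a bound quiver algebra on a two-point quiver:
`e_i e_j = δ_{ij} e_i`, `e_1 + e_2 = 1`, `e_{s(a)} a = a = a e_{t(a)}`, together with the
prescribed relations `rels` (each pair `(x, y) ∈ rels` imposes `x = y`). -/
inductive QuivRel (K : Type) [Field K] (σ : Type) (s t : σ → Fin 2)
    (rels : Set (FreeAlgebra K (TPGen σ) × FreeAlgebra K (TPGen σ))) :
    FreeAlgebra K (TPGen σ) → FreeAlgebra K (TPGen σ) → Prop
  | idem (i : Fin 2) : QuivRel K σ s t rels (vtx K i * vtx K i) (vtx K i)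
  | orth (i j : Fin 2) : i ≠ j → QuivRel K σ s t rels (vtx K i * vtx K j) 0
  | vsum : QuivRel K σ s t rels (vtx K 0 + vtx K 1) 1
  | src (a : σ) : QuivRel K σ s t rels (vtx K (s a) * arr K a) (arr K a)
  | tgt (a : σ) : QuivRel K σ s t rels (arr K a * vtx K (t a)) (arr K a)
  | rel (p : FreeAlgebra K (TPGen σ) × FreeAlgebra K (TPGen σ)) :
      p ∈ rels → QuivRel K σ s t rels p.1 p.2

/-- The bound quiver algebra of a two-point quiver with relations `rels`. -/
abbrev BoundQuiverAlgebra (K : Type) [Field K] (σ : Type) (s t : σ → Fin 2)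
    (rels : Set (FreeAlgebra K (TPGen σ) × FreeAlgebra K (TPGen σ))) : Type :=
  RingQuot (QuivRel K σ s t rels)

/-! Concrete two-point quivers used below.  Vertices are `0` ("1") and `1` ("2"). -/

/- Quiver `μ : 1 → 2`, loop `β` at `2`. -/
namespace QA
def s : Fin 2 → Fin 2 := ![0, 1]
def t : Fin 2 → Fin 2 := ![1, 1]
def mu (K : Type) [Field K] : FreeAlgebra K (TPGen (Fin 2)) := arr K (0 : Fin 2)
def be (K : Type) [Field K] : FreeAlgebra K (TPGen (Fin 2)) := arr K (1 : Fin 2)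
end QA

/- Quiver: loop `α` at `1`, `μ : 1 → 2`, loop `β` at `2`. -/
namespace QB
def s : Fin 3 → Fin 2 := ![0, 0, 1]
def t : Fin 3 → Fin 2 := ![0, 1, 1]
def al (K : Type) [Field K] : FreeAlgebra K (TPGen (Fin 3)) := arr K (0 : Fin 3)
def mu (K : Type) [Field K] : FreeAlgebra K (TPGen (Fin 3)) := arr K (1 : Fin 3)
def be (K : Type) [Field K] : FreeAlgebra K (TPGen (Fin 3)) := arr K (2 : Fin 3)
end QB

/- Quiver: `μ : 1 → 2`, loops `β₁, β₂` at `2`. -/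
namespace QC
def s : Fin 3 → Fin 2 := ![0, 1, 1]
def t : Fin 3 → Fin 2 := ![1, 1, 1]
def mu (K : Type) [Field K] : FreeAlgebra K (TPGen (Fin 3)) := arr K (0 : Fin 3)
def b1 (K : Type) [Field K] : FreeAlgebra K (TPGen (Fin 3)) := arr K (1 : Fin 3)
def b2 (K : Type) [Field K] : FreeAlgebra K (TPGen (Fin 3)) := arr K (2 : Fin 3)
end QC

/- Quiver: loop `α` at `1`, `μ : 1 → 2`, `ν : 2 → 1`. -/
namespace QD
def s : Fin 3 → Fin 2 := ![0, 0, 1]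
def t : Fin 3 → Fin 2 := ![0, 1, 0]
def al (K : Type) [Field K] : FreeAlgebra K (TPGen (Fin 3)) := arr K (0 : Fin 3)
def mu (K : Type) [Field K] : FreeAlgebra K (TPGen (Fin 3)) := arr K (1 : Fin 3)
def nu (K : Type) [Field K] : FreeAlgebra K (TPGen (Fin 3)) := arr K (2 : Fin 3)
end QD

/- Quiver: loops `α` at `1` and `β` at `2`, `μ : 1 → 2`, `ν : 2 → 1`. -/
namespace QE
def s : Fin 4 → Fin 2 := ![0, 1, 0, 1]
def t : Fin 4 → Fin 2 := ![0, 1, 1, 0]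
def al (K : Type) [Field K] : FreeAlgebra K (TPGen (Fin 4)) := arr K (0 : Fin 4)
def be (K : Type) [Field K] : FreeAlgebra K (TPGen (Fin 4)) := arr K (1 : Fin 4)
def mu (K : Type) [Field K] : FreeAlgebra K (TPGen (Fin 4)) := arr K (2 : Fin 4)
def nu (K : Type) [Field K] : FreeAlgebra K (TPGen (Fin 4)) := arr K (3 : Fin 4)
end QE

/- Quiver: `μ : 1 → 2`, `ν : 2 → 1`. -/
namespace QF
def s : Fin 2 → Fin 2 := ![0, 1]
def t : Fin 2 → Fin 2 := ![1, 0]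
def mu (K : Type) [Field K] : FreeAlgebra K (TPGen (Fin 2)) := arr K (0 : Fin 2)
def nu (K : Type) [Field K] : FreeAlgebra K (TPGen (Fin 2)) := arr K (1 : Fin 2)
end QF

/- The Kronecker quiver: `μ₁, μ₂ : 1 → 2`. -/
namespace QG
def s : Fin 2 → Fin 2 := ![0, 0]
def t : Fin 2 → Fin 2 := ![1, 1]
end QG

/- Quiver: `μ₁, μ₂ : 1 → 2`, `ν₁, ν₂ : 2 → 1`. -/
namespace QH
def s : Fin 4 → Fin 2 := ![0, 0, 1, 1]
def t : Fin 4 → Fin 2 := ![1, 1, 0, 0]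
def mu1 (K : Type) [Field K] : FreeAlgebra K (TPGen (Fin 4)) := arr K (0 : Fin 4)
def mu2 (K : Type) [Field K] : FreeAlgebra K (TPGen (Fin 4)) := arr K (1 : Fin 4)
def nu1 (K : Type) [Field K] : FreeAlgebra K (TPGen (Fin 4)) := arr K (2 : Fin 4)
def nu2 (K : Type) [Field K] : FreeAlgebra K (TPGen (Fin 4)) := arr K (3 : Fin 4)
end QH

/- Quiver: loop `α` at `1`, `μ : 1 → 2`. -/
namespace QI
def s : Fin 2 → Fin 2 := ![0, 0]
def t : Fin 2 → Fin 2 := ![0, 1]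
def al (K : Type) [Field K] : FreeAlgebra K (TPGen (Fin 2)) := arr K (0 : Fin 2)
def mu (K : Type) [Field K] : FreeAlgebra K (TPGen (Fin 2)) := arr K (1 : Fin 2)
end QI

/- Quiver: loops `α₁, α₂` at `1`, `μ : 1 → 2`. -/
namespace QJ
def s : Fin 3 → Fin 2 := ![0, 0, 0]
def t : Fin 3 → Fin 2 := ![0, 0, 1]
def a1 (K : Type) [Field K] : FreeAlgebra K (TPGen (Fin 3)) := arr K (0 : Fin 3)
def a2 (K : Type) [Field K] : FreeAlgebra K (TPGen (Fin 3)) := arr K (1 : Fin 3)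
def mu (K : Type) [Field K] : FreeAlgebra K (TPGen (Fin 3)) := arr K (2 : Fin 3)
end QJ

/- Quiver: `μ₁, μ₂ : 1 → 2`, `ν : 2 → 1`. -/
namespace QK
def s : Fin 3 → Fin 2 := ![0, 0, 1]
def t : Fin 3 → Fin 2 := ![1, 1, 0]
def mu1 (K : Type) [Field K] : FreeAlgebra K (TPGen (Fin 3)) := arr K (0 : Fin 3)
def mu2 (K : Type) [Field K] : FreeAlgebra K (TPGen (Fin 3)) := arr K (1 : Fin 3)
def nu (K : Type) [Field K] : FreeAlgebra K (TPGen (Fin 3)) := arr K (2 : Fin 3)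
end QK

/- Quiver: `μ₁, μ₂, μ₃ : 1 → 2`. -/
namespace QL
def s : Fin 3 → Fin 2 := ![0, 0, 0]
def t : Fin 3 → Fin 2 := ![1, 1, 1]
end QL

/- Quiver: loop `α` at `1`, `μ₁, μ₂ : 1 → 2`. -/
namespace QM
def s : Fin 3 → Fin 2 := ![0, 0, 0]
def t : Fin 3 → Fin 2 := ![0, 1, 1]
def al (K : Type) [Field K] : FreeAlgebra K (TPGen (Fin 3)) := arr K (0 : Fin 3)
def mu1 (K : Type) [Field K] : FreeAlgebra K (TPGen (Fin 3)) := arr K (1 : Fin 3)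
def mu2 (K : Type) [Field K] : FreeAlgebra K (TPGen (Fin 3)) := arr K (2 : Fin 3)
end QM

end TwoPoint

namespace TwoPoint

/-! ### The path algebra of the quiver `Q(i,j,m,n)` and admissible presentations

`Q(i,j,m,n)` has two vertices `1, 2`, `i` loops at `1`, `j` loops at `2`, `m` arrows
`1 → 2` and `n` arrows `2 → 1`. -/

/-- Arrows of `Q(i,j,m,n)`. -/
def QArrow (i j m n : ℕ) : Type := (Fin i ⊕ Fin j) ⊕ (Fin m ⊕ Fin n)

/-- Sources of arrows of `Q(i,j,m,n)`. -/
def QSrc (i j m n : ℕ) : QArrow i j m n → Fin 2 :=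
  Sum.elim (Sum.elim (fun _ => 0) fun _ => 1) (Sum.elim (fun _ => 0) fun _ => 1)

/-- Targets of arrows of `Q(i,j,m,n)`. -/
def QTgt (i j m n : ℕ) : QArrow i j m n → Fin 2 :=
  Sum.elim (Sum.elim (fun _ => 0) fun _ => 1) (Sum.elim (fun _ => 1) fun _ => 0)

/-- The path algebra `KQ(i,j,m,n)` (no relations). -/
abbrev PathAlgebra (K : Type) [Field K] (i j m n : ℕ) : Type :=
  BoundQuiverAlgebra K (QArrow i j m n) (QSrc i j m n) (QTgt i j m n) ∅

/-- The image of an arrow in the path algebra. -/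
def pathArrow (K : Type) [Field K] {i j m n : ℕ} (x : QArrow i j m n) :
    PathAlgebra K i j m n :=
  RingQuot.mkAlgHom K _ (arr K x)

/-- The set of products of exactly `N` elements of `S`. -/
def NProd {R : Type} [Monoid R] (S : Set R) (N : ℕ) : Set R :=
  {x | ∃ l : List R, l.length = N ∧ (∀ y ∈ l, y ∈ S) ∧ x = l.prod}

/-- The two-sided ideal generated by `S`, as a `K`-submodule. -/
def twoSidedSpan (K : Type) [CommRing K] (R : Type) [Ring R] [Algebra K R] (S : Set R) :
    Submodule K R :=
  Submodule.span K {z | ∃ p s q : R, s ∈ S ∧ z = p * s * q}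

/-- `π` presents `Λ` as the quotient of the path algebra `KQ(i,j,m,n)` by an admissible
ideal `I = ker π`: `π` is surjective, `I` is contained in the square `R²` of the arrow
ideal `R`, and `Rᴺ ⊆ I` for some `N ≥ 2`. -/
def IsAdmissiblePresentation (K : Type) [Field K] {i j m n : ℕ} (Λ : Type) [Ring Λ]
    [Algebra K Λ] (π : PathAlgebra K i j m n →ₐ[K] Λ) : Prop :=
  Function.Surjective π ∧
  (∀ x, π x = 0 →
    x ∈ twoSidedSpan K (PathAlgebra K i j m n) (NProd (Set.range (pathArrow K)) 2)) ∧
  ∃ N : ℕ, 2 ≤ N ∧ ∀ x ∈ NProd (Set.range (pathArrow K (i := i) (j := j) (m := m) (n := n))) N,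
    π x = 0

end TwoPoint

namespace TwoPoint

/-! ### The left ideal attached to an idempotent -/

/-- The left ideal `R e`, described as the set of elements fixed by right multiplication
by `e` (for `e` idempotent). -/
def idemIdeal (R : Type) [Ring R] (e : R) : Submodule R R where
  carrier := {r | r * e = r}
  add_mem' {a b} ha hb := by
    simp only [Set.mem_ofPred_eq] at *
    rw [add_mul, ha, hb]
  zero_mem' := zero_mul e
  smul_mem' c x hx := by
    simp only [Set.mem_ofPred_eq, smul_eq_mul] at *
    rw [mul_assoc, hx]

theorem mem_idemIdeal {R : Type} [Ring R] {e r : R} : r ∈ idemIdeal R e ↔ r * e = r := Iff.rfl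

/-- The generator `e` of `R e`. -/
def idemGen {R : Type} [Ring R] {e : R} (he : e * e = e) : idemIdeal R e := ⟨e, he⟩

/-- The homomorphism `R e → N`, `r ↦ r • n`. -/
def idemHom {R : Type} [Ring R] (e : R) {N : Type} [AddCommGroup N] [Module R N] (n : N) :
    idemIdeal R e →ₗ[R] N :=
  (LinearMap.toSpanSingleton R N n).comp (idemIdeal R e).subtype

@[simp]
theorem idemHom_apply {R : Type} [Ring R] (e : R) {N : Type} [AddCommGroup N] [Module R N]
    (n : N) (r : idemIdeal R e) : idemHom e n r = (r : R) • n := rfl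

theorem smul_idemGen {R : Type} [Ring R] {e : R} (he : e * e = e) (r : idemIdeal R e) :
    (r : R) • idemGen he = r := Subtype.ext r.2

theorem idem_smul_map_idemGen {R : Type} [Ring R] {e : R} (he : e * e = e) {N : Type}
    [AddCommGroup N] [Module R N] (f : idemIdeal R e →ₗ[R] N) :
    e • f (idemGen he) = f (idemGen he) := by
  rw [← map_smul]
  exact congrArg f (smul_idemGen he (idemGen he))

theorem map_eq_smul_map_idemGen {R : Type} [Ring R] {e : R} (he : e * e = e) {N : Type}
    [AddCommGroup N] [Module R N] (f : idemIdeal R e →ₗ[R] N) (r : idemIdeal R e) :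
    f r = (r : R) • f (idemGen he) := by
  rw [← map_smul, smul_idemGen]

theorem idemIdeal_hom_ext {R : Type} [Ring R] {e : R} (he : e * e = e) {N : Type}
    [AddCommGroup N] [Module R N] {f g : idemIdeal R e →ₗ[R] N}
    (h : f (idemGen he) = g (idemGen he)) : f = g := by
  ext r
  rw [map_eq_smul_map_idemGen he f, map_eq_smul_map_idemGen he g, h]

/-- The projection `R → R e`, `r ↦ r e`. -/
def idemProj {R : Type} [Ring R] {e : R} (he : e * e = e) : R →ₗ[R] idemIdeal R e :=
  LinearMap.toSpanSingleton R (idemIdeal R e) (idemGen he)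

theorem idemProj_comp_subtype {R : Type} [Ring R] {e : R} (he : e * e = e) :
    (idemProj he).comp (idemIdeal R e).subtype = LinearMap.id := by
  ext r
  exact congrArg Subtype.val (smul_idemGen he r)

theorem projective_idemIdeal {R : Type} [Ring R] {e : R} (he : e * e = e) :
    Module.Projective R (idemIdeal R e) :=
  Module.Projective.of_split _ _ (idemProj_comp_subtype he)

theorem finite_idemIdeal {R : Type} [Ring R] {e : R} (he : e * e = e) :
    Module.Finite R (idemIdeal R e) :=
  Module.Finite.of_surjective (idemProj he) fun r =>
    ⟨r, LinearMap.congr_fun (idemProj_comp_subtype he) r⟩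

/-! ### Local idempotents -/

/-- An idempotent `e` such that any element of `e R` outside the radical generates `R e` after
right multiplication by `e`. -/
structure IsLocalIdem (R : Type) [Ring R] (e : R) : Prop where
  idem : e * e = e
  ne_zero : e ≠ 0
  generates : ∀ r, e * r = r → r ∈ Ring.jacobson R ∨ ∃ y, y * (r * e) = e

theorem mem_ring_jacobson_iff {R : Type} [Ring R] {x : R} :
    x ∈ Ring.jacobson R ↔ ∀ y, ∃ z, z * y * x + z - 1 = 0 := by
  rw [← Ideal.jacobson_bot, Ideal.mem_jacobson_iff]
  simp only [Ideal.mem_bot]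

theorem IsLocalIdem.notMem_jacobson {R : Type} [Ring R] {e : R} (h : IsLocalIdem R e) :
    e ∉ Ring.jacobson R := by
  intro he
  obtain ⟨z, hz⟩ := mem_ring_jacobson_iff.1 he (-1)
  apply h.ne_zero
  have : (z * -1 * e + z - 1) * e = -e := by
    have : z * -1 * e * e = - (z * e) := by rw [mul_assoc, h.idem]; simp
    rw [sub_mul, add_mul, this]; simp
  rw [hz, zero_mul] at this
  simpa using this.symm

theorem IsLocalIdem.isIndecModule {R : Type} [Ring R] {e : R} (h : IsLocalIdem R e) :
    IsIndecModule R (idemIdeal R e) := by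
  have key : ∀ (N : Submodule R (idemIdeal R e)) (n : idemIdeal R e), n ∈ N →
      e * (n : R) ∉ Ring.jacobson R → N = ⊤ := by
    intro N n hn hnj
    obtain hj | ⟨y, hy⟩ := h.generates (e * n) (by rw [← mul_assoc, h.idem])
    · exact absurd hj hnj
    · have : idemGen h.idem ∈ N := by
        have h1 : idemGen h.idem = (y * e) • n := by
          apply Subtype.ext
          have := n.2
          rw [mem_idemIdeal] at this
          simp only [idemGen, SetLike.val_smul, smul_eq_mul]
          rw [mul_assoc e, this] at hy
          rw [mul_assoc, hy]
        rw [h1]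
        exact N.smul_mem _ hn
      rw [eq_top_iff]
      intro r _
      rw [← smul_idemGen h.idem r]
      exact N.smul_mem _ this
  refine ⟨⟨idemGen h.idem, 0, fun h0 => h.ne_zero (congrArg Subtype.val h0)⟩, ?_⟩
  intro N₁ N₂ hc
  have hmem : idemGen h.idem ∈ N₁ ⊔ N₂ := by rw [hc.sup_eq_top]; trivial
  obtain ⟨n₁, hn₁, n₂, hn₂, hsum⟩ := Submodule.mem_sup.1 hmem
  have hsum' : e * (n₁ : R) + e * (n₂ : R) = e := by
    have := congrArg (fun x : idemIdeal R e => e * (x : R)) hsum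
    simpa [mul_add, idemGen, h.idem] using this
  by_cases h1 : e * (n₁ : R) ∈ Ring.jacobson R
  · have h2 : e * (n₂ : R) ∉ Ring.jacobson R := fun h2 =>
      h.notMem_jacobson (hsum' ▸ add_mem h1 h2)
    have := key N₂ n₂ hn₂ h2
    subst this
    exact Or.inl (by simpa using hc.inf_eq_bot)
  · have := key N₁ n₁ hn₁ h1
    subst this
    exact Or.inr (by simpa using hc.inf_eq_bot)

theorem exists_hom_notMem_jacobson {R : Type} [Ring R] {Q : Type} [AddCommGroup Q] [Module R Q]
    [Module.Projective R Q] {q : Q} (hq : q ∉ Ring.jacobson R • (⊤ : Submodule R Q)) :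
    ∃ φ : Q →ₗ[R] R, φ q ∉ Ring.jacobson R := by
  by_contra! hcon
  apply hq
  obtain ⟨s, hs⟩ := Module.projective_def'.1 (inferInstance : Module.Projective R Q)
  have : q = Finsupp.linearCombination R id (s q) := (LinearMap.congr_fun hs q).symm
  rw [this, Finsupp.linearCombination_apply, Finsupp.sum]
  exact Submodule.sum_mem _ fun x _ =>
    Submodule.smul_mem_smul (hcon ((Finsupp.lapply x).comp s)) trivial

/-- A finitely generated projective module generated by its `e`-part is a power of `R e`. -/
theorem IsLocalIdem.exists_equiv_pi {K R : Type} [Field K] [Ring R] [Algebra K R] {e : R}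
    (h : IsLocalIdem R e) :
    ∀ (d : ℕ) (Q : Type) [AddCommGroup Q] [Module R Q] [Module K Q] [IsScalarTower K R Q]
      [FiniteDimensional K Q] [Module.Projective R Q],
      Module.finrank K Q = d → Submodule.span R {q : Q | e • q = q} = ⊤ →
      ∃ a : ℕ, Nonempty (Q ≃ₗ[R] (Fin a → idemIdeal R e)) := by
  intro d
  induction d using Nat.strong_induction_on with
  | _ d ih =>
  intro Q _ _ _ _ _ _ hd hgen
  have : Module.Finite R Q := Module.Finite.of_restrictScalars_finite K R Q
  rcases subsingleton_or_nontrivial Q with hQ | hQ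
  · exact ⟨0, ⟨LinearEquiv.ofSubsingleton _ _⟩⟩
  · obtain ⟨q, hq, hqj⟩ : ∃ q : Q, e • q = q ∧ q ∉ Ring.jacobson R • (⊤ : Submodule R Q) := by
      by_contra! hcon
      have := Submodule.jacobson_smul_lt_top (R := R) (⊤ : Submodule R Q)
      refine this.ne (eq_top_iff.2 ?_)
      exact hgen.ge.trans (Submodule.span_le.2 hcon)
    obtain ⟨φ, hφ⟩ := exists_hom_notMem_jacobson hqj
    obtain hj | ⟨y, hy⟩ := h.generates (φ q) (by rw [← smul_eq_mul, ← map_smul, hq])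
    · exact absurd hj hφ
    · let ψ : Q →ₗ[R] idemIdeal R e := (idemProj h.idem).comp φ
      let s : idemIdeal R e →ₗ[R] Q := idemHom e (y • q)
      have hs : ψ.comp s = LinearMap.id := by
        apply idemIdeal_hom_ext h.idem
        apply Subtype.ext
        simp only [ψ, s, LinearMap.comp_apply, idemHom_apply, map_smul, LinearMap.id_apply]
        simp only [idemProj, LinearMap.toSpanSingleton_apply, idemGen, SetLike.val_smul,
          smul_eq_mul]
        rw [hy, h.idem]
      have hs' : ∀ x, ψ (s x) = x := fun x => LinearMap.congr_fun hs x
      let E : Q ≃ₗ[R] LinearMap.ker ψ × idemIdeal R e :=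
        { toFun := fun x => (⟨x - s (ψ x), by simp [hs']⟩, ψ x)
          map_add' := fun x y => by
            ext <;> simp
            abel
          map_smul' := fun c x => by ext <;> simp [smul_sub]
          invFun := fun p => p.1 + s p.2
          left_inv := fun x => by simp
          right_inv := fun p => by
            have h1 : ψ p.1 = 0 := p.1.2
            ext <;> simp [hs', h1] }
      have hprojK : Module.Projective R (LinearMap.ker ψ) :=
        Module.Projective.of_split (E.symm.toLinearMap.comp (LinearMap.inl R _ _))
          ((LinearMap.fst R _ _).comp E.toLinearMap) (by ext; simp)
      have hlt : Module.finrank K (LinearMap.ker ψ) < d := by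
        rw [← hd]
        have hle : (LinearMap.ker ψ).restrictScalars K < ⊤ := by
          rw [lt_top_iff_ne_top]
          intro htop
          have : s (idemGen h.idem) ∈ (LinearMap.ker ψ).restrictScalars K := by
            rw [htop]; trivial
          have h0 : ψ (s (idemGen h.idem)) = 0 := this
          rw [hs'] at h0
          exact h.ne_zero (congrArg Subtype.val h0)
        exact Submodule.finrank_lt hle.ne
      have hfin : FiniteDimensional K (LinearMap.ker ψ) :=
        FiniteDimensional.finiteDimensional_submodule ((LinearMap.ker ψ).restrictScalars K)
      obtain ⟨a, ⟨F⟩⟩ := ih _ hlt (LinearMap.ker ψ) rfl (by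
        let ρ : Q →ₗ[R] LinearMap.ker ψ := (LinearMap.fst R _ _).comp E.toLinearMap
        have hρ : Function.Surjective ρ := Prod.fst_surjective.comp E.surjective
        rw [eq_top_iff, ← LinearMap.range_eq_top.2 hρ, LinearMap.range_eq_map, ← hgen,
          Submodule.map_span]
        apply Submodule.span_mono
        rintro _ ⟨x, hx, rfl⟩
        change e • ρ x = ρ x
        rw [← map_smul]
        exact congrArg ρ hx)
      refine ⟨a + 1, ⟨?_⟩⟩
      exact ((E.trans (F.prodCongr (LinearEquiv.refl R _))).trans (LinearEquiv.prodComm R _ _)).trans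
        (Fin.consLinearEquiv R fun _ : Fin (a + 1) => idemIdeal R e)
/-! ### Two-term complexes of projectives -/

/-- Two-term complexes `f` and `g` with `Hom(f, g[1]) = 0` up to homotopy. -/
def ExtVanish {R : Type} [Ring R] {Q₁ Q₀ Q₁' Q₀' : Type}
    [AddCommGroup Q₁] [AddCommGroup Q₀] [AddCommGroup Q₁'] [AddCommGroup Q₀']
    [Module R Q₁] [Module R Q₀] [Module R Q₁'] [Module R Q₀']
    (f : Q₁ →ₗ[R] Q₀) (g : Q₁' →ₗ[R] Q₀') : Prop :=
  ∀ h : Q₁ →ₗ[R] Q₀', ∃ (u : Q₀ →ₗ[R] Q₀') (v : Q₁ →ₗ[R] Q₁'), ∀ x, h x = u (f x) + g (v x)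

section ExtVanish

variable {R : Type} [Ring R] {Q₁ Q₀ Q₁' Q₀' A₁ A₀ : Type}
  [AddCommGroup Q₁] [AddCommGroup Q₀] [AddCommGroup Q₁'] [AddCommGroup Q₀']
  [AddCommGroup A₁] [AddCommGroup A₀]
  [Module R Q₁] [Module R Q₀] [Module R Q₁'] [Module R Q₀'] [Module R A₁] [Module R A₀]
  {f : Q₁ →ₗ[R] Q₀} {g : Q₁' →ₗ[R] Q₀'}

/-- `g` is a retract of `f` in the category of two-term complexes. -/
structure IsRetract (g : A₁ →ₗ[R] A₀) (f : Q₁ →ₗ[R] Q₀) (i₁ : A₁ →ₗ[R] Q₁) (i₀ : A₀ →ₗ[R] Q₀)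
    (r₁ : Q₁ →ₗ[R] A₁) (r₀ : Q₀ →ₗ[R] A₀) : Prop where
  map_incl : ∀ x, f (i₁ x) = i₀ (g x)
  map_retr : ∀ x, r₀ (f x) = g (r₁ x)
  retr_incl₁ : ∀ x, r₁ (i₁ x) = x
  retr_incl₀ : ∀ x, r₀ (i₀ x) = x

theorem ExtVanish.retract_left {a : A₁ →ₗ[R] A₀} {i₁ : A₁ →ₗ[R] Q₁} {i₀ : A₀ →ₗ[R] Q₀}
    {r₁ : Q₁ →ₗ[R] A₁} {r₀ : Q₀ →ₗ[R] A₀} (hr : IsRetract a f i₁ i₀ r₁ r₀)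
    (h : ExtVanish f g) : ExtVanish a g := by
  intro t
  obtain ⟨u, v, huv⟩ := h (t.comp r₁)
  refine ⟨u.comp i₀, v.comp i₁, fun x => ?_⟩
  have := huv (i₁ x)
  simpa [hr.retr_incl₁, hr.map_incl] using this

theorem ExtVanish.retract_right {a : A₁ →ₗ[R] A₀} {i₁ : A₁ →ₗ[R] Q₁'} {i₀ : A₀ →ₗ[R] Q₀'}
    {r₁ : Q₁' →ₗ[R] A₁} {r₀ : Q₀' →ₗ[R] A₀} (hr : IsRetract a g i₁ i₀ r₁ r₀)
    (h : ExtVanish f g) : ExtVanish f a := by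
  intro t
  obtain ⟨u, v, huv⟩ := h (i₀.comp t)
  refine ⟨r₀.comp u, r₁.comp v, fun x => ?_⟩
  have := congrArg r₀ (huv x)
  simpa [hr.retr_incl₀, hr.map_retr] using this

theorem ExtVanish.exists_factor [Module.Projective R Q₁] (h : ExtVanish f g)
    (t : Q₁ →ₗ[R] Q₀' ⧸ LinearMap.range g) :
    ∃ t' : Q₀ →ₗ[R] Q₀' ⧸ LinearMap.range g, t = t'.comp f := by
  obtain ⟨s, hs⟩ := Module.projective_lifting_property (LinearMap.range g).mkQ t
    (Submodule.mkQ_surjective _)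
  obtain ⟨u, v, huv⟩ := h s
  refine ⟨(LinearMap.range g).mkQ.comp u, ?_⟩
  ext x
  rw [← hs]
  simp only [LinearMap.comp_apply, huv, map_add]
  have : (LinearMap.range g).mkQ (g (v x)) = 0 := by simp
  rw [this, add_zero]

end ExtVanish

/-! ### Dimensions of homomorphism spaces -/

/-- The `K`-subspace `e N` of a module `N`. -/
def idemPart (K : Type) {R : Type} [Field K] [Ring R] [Algebra K R] (e : R) (N : Type)
    [AddCommGroup N] [Module R N] [Module K N] [IsScalarTower K R N] : Submodule K N where
  carrier := {n | e • n = n}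
  add_mem' {a b} ha hb := by
    simp only [Set.mem_ofPred_eq] at *
    rw [smul_add, ha, hb]
  zero_mem' := smul_zero e
  smul_mem' c x hx := by
    simp only [Set.mem_ofPred_eq] at *
    rw [smul_algebra_smul_comm, hx]

section Hom

variable {K R : Type} [Field K] [Ring R] [Algebra K R] {e : R}
  {N : Type} [AddCommGroup N] [Module R N] [Module K N] [IsScalarTower K R N]

theorem pi_map_eq_sum (he : e * e = e) {ι M : Type} [Fintype ι] [DecidableEq ι] [AddCommGroup M]
    [Module R M] (u : (ι → idemIdeal R e) →ₗ[R] M) (p : ι → idemIdeal R e) :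
    u p = ∑ i, (p i : R) • u (Pi.single i (idemGen he)) := by
  have : p = ∑ i, (p i : R) • (Pi.single i (idemGen he) : ι → idemIdeal R e) := by
    have h1 : ∀ i, (p i : R) • (Pi.single i (idemGen he) : ι → idemIdeal R e)
        = Pi.single i (p i) := fun i => by
      rw [← Pi.single_smul, smul_idemGen]
    simp only [h1, Finset.univ_sum_single]
  conv_lhs => rw [this]
  simp only [map_sum, map_smul]

variable (K N) in
/-- `Hom(R e, N) ≃ e N`. -/
def idemHomEquiv (he : e * e = e) : (idemIdeal R e →ₗ[R] N) ≃ₗ[K] idemPart K e N where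
  toFun f := ⟨f (idemGen he), idem_smul_map_idemGen he f⟩
  map_add' _ _ := rfl
  map_smul' _ _ := rfl
  invFun n := idemHom e (n : N)
  left_inv f := idemIdeal_hom_ext he (idem_smul_map_idemGen he f)
  right_inv n := Subtype.ext n.2

variable (K N) in
/-- `Hom((R e)ⁿ, N) ≃ (e N)ⁿ`. -/
def piIdemHomEquiv (he : e * e = e) (ι : Type) [Fintype ι] [DecidableEq ι] :
    ((ι → idemIdeal R e) →ₗ[R] N) ≃ₗ[K] (ι → idemPart K e N) :=
  (LinearMap.lsum R (fun _ : ι => idemIdeal R e) K).symm.trans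
    (LinearEquiv.piCongrRight fun _ => idemHomEquiv K N he)

theorem finiteDimensional_pi_hom [FiniteDimensional K N] (he : e * e = e) (ι : Type) [Fintype ι]
    [DecidableEq ι] : FiniteDimensional K ((ι → idemIdeal R e) →ₗ[R] N) :=
  (piIdemHomEquiv K N he ι).symm.finiteDimensional

theorem finrank_pi_hom [FiniteDimensional K N] (he : e * e = e) (a : ℕ) :
    Module.finrank K ((Fin a → idemIdeal R e) →ₗ[R] N)
      = a * Module.finrank K (idemPart K e N) := by
  rw [(piIdemHomEquiv K N he (Fin a)).finrank_eq, Module.finrank_pi_fintype]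
  simp

theorem finrank_hom_coker {Q₁ Q₀ : Type} [AddCommGroup Q₁] [AddCommGroup Q₀] [Module R Q₁]
    [Module R Q₀] (f : Q₁ →ₗ[R] Q₀) [FiniteDimensional K (Q₀ →ₗ[R] N)]
    (hsurj : ∀ h : Q₁ →ₗ[R] N, ∃ h' : Q₀ →ₗ[R] N, h = h'.comp f) :
    Module.finrank K ((Q₀ ⧸ LinearMap.range f) →ₗ[R] N) + Module.finrank K (Q₁ →ₗ[R] N)
      = Module.finrank K (Q₀ →ₗ[R] N) := by
  let C : (Q₀ →ₗ[R] N) →ₗ[K] (Q₁ →ₗ[R] N) :=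
    { toFun := fun h => h.comp f
      map_add' := fun _ _ => rfl
      map_smul' := fun _ _ => rfl }
  have hC : Function.Surjective C := fun h => (hsurj h).imp fun _ h => h.symm
  let D : ((Q₀ ⧸ LinearMap.range f) →ₗ[R] N) ≃ₗ[K] LinearMap.ker C :=
    { toFun := fun h => ⟨h.comp (LinearMap.range f).mkQ, by
        rw [LinearMap.mem_ker]
        ext x
        have : (LinearMap.range f).mkQ (f x) = 0 := by simp
        simp only [C, LinearMap.coe_mk, AddHom.coe_mk, LinearMap.comp_apply, this, map_zero,
          LinearMap.zero_apply]⟩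
      map_add' := fun _ _ => rfl
      map_smul' := fun _ _ => rfl
      invFun := fun h => (LinearMap.range f).liftQ h (by
        rintro _ ⟨x, rfl⟩
        exact LinearMap.congr_fun h.2 x)
      left_inv := fun h => by ext x; rfl
      right_inv := fun h => by ext x; rfl }
  rw [D.finrank_eq, ← LinearMap.finrank_range_add_finrank_ker C, LinearMap.range_eq_top.2 hC,
    finrank_top, add_comm]

end Hom
/-! ### Algebras with two arrows between the same vertices -/

theorem isLocalIdem_of_characters {K R : Type} [Field K] [Ring R] [Algebra K R] {e e' : R}
    {χ χ' : R →ₗ[K] K} (idem : e * e = e) (orth : e' * e = 0) (sum : e + e' = 1)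
    (χ_mul : ∀ r s, χ (r * s) = χ r * χ s) (χ'_mul : ∀ r s, χ' (r * s) = χ' r * χ' s)
    (h₁ : χ e = 1) (h₂ : χ e' = 0) (h₁' : χ' e = 0) (h₂' : χ' e' = 1)
    (nil : ∀ r, χ r = 0 → χ' r = 0 → IsNilpotent r) : IsLocalIdem R e := by
  refine ⟨idem, fun h0 => ?_, fun r hr => ?_⟩
  · rw [h0, map_zero] at h₁
    exact zero_ne_one h₁
  · have hχ' : χ' r = 0 := by rw [← hr, χ'_mul, h₁', zero_mul]
    by_cases hd : χ r = 0
    · left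
      rw [mem_ring_jacobson_iff]
      intro y
      have hn : IsNilpotent (y * r) := nil _ (by rw [χ_mul, hd, mul_zero])
        (by rw [χ'_mul, hχ', mul_zero])
      obtain ⟨z, hz⟩ := hn.isUnit_one_add.exists_left_inv
      refine ⟨z, ?_⟩
      rw [mul_add, mul_one] at hz
      rw [mul_assoc, add_comm, hz, sub_self]
    · right
      have hχ1 : χ 1 = 1 := by rw [← sum, map_add, h₁, h₂, add_zero]
      have hχ1' : χ' 1 = 1 := by rw [← sum, map_add, h₁', h₂', zero_add]
      have hn : IsNilpotent ((χ r)⁻¹ • (r * e) + e' - 1) := by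
        apply nil
        · simp [χ_mul, h₁, h₂, hχ1, hd]
        · simp [χ'_mul, h₁', h₂', hχ1']
      obtain ⟨y, hy⟩ := hn.isUnit_add_one.exists_left_inv
      refine ⟨(χ r)⁻¹ • y, ?_⟩
      have := congrArg (· * e) hy
      simpa [mul_assoc, mul_add, add_mul, idem, orth] using this

/-- Structure witnessing that an algebra with two simple modules has (at least) two arrows between
its two vertices: primitive orthogonal idempotents, the characters of the simple modules, and two
derivations dual to the arrows. -/
structure TwoArrowData (K R : Type) [Field K] [Ring R] [Algebra K R] where
  e₁ : R
  e₂ : R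
  χ₁ : R →ₗ[K] K
  χ₂ : R →ₗ[K] K
  c : Fin 2 → R →ₗ[K] K
  idem₁ : e₁ * e₁ = e₁
  idem₂ : e₂ * e₂ = e₂
  orth₁₂ : e₁ * e₂ = 0
  orth₂₁ : e₂ * e₁ = 0
  sum : e₁ + e₂ = 1
  χ₁_mul : ∀ r s, χ₁ (r * s) = χ₁ r * χ₁ s
  χ₂_mul : ∀ r s, χ₂ (r * s) = χ₂ r * χ₂ s
  χ₁_e₁ : χ₁ e₁ = 1
  χ₁_e₂ : χ₁ e₂ = 0
  χ₂_e₁ : χ₂ e₁ = 0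
  χ₂_e₂ : χ₂ e₂ = 1
  nil : ∀ r, χ₁ r = 0 → χ₂ r = 0 → IsNilpotent r
  c_mul : ∀ l r s, c l (r * s) = χ₂ r * c l s + c l r * χ₁ s
  c_surj : ∀ y : Fin 2 → K, ∃ x, e₂ * x * e₁ = x ∧ ∀ l, c l x = y l

namespace TwoArrowData

variable {K R : Type} [Field K] [Ring R] [Algebra K R] (D : TwoArrowData K R)

theorem isLocalIdem₁ : IsLocalIdem R D.e₁ :=
  isLocalIdem_of_characters D.idem₁ D.orth₂₁ D.sum D.χ₁_mul D.χ₂_mul D.χ₁_e₁ D.χ₁_e₂ D.χ₂_e₁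
    D.χ₂_e₂ D.nil

theorem isLocalIdem₂ : IsLocalIdem R D.e₂ :=
  isLocalIdem_of_characters D.idem₂ D.orth₁₂ (by rw [add_comm, D.sum]) D.χ₂_mul D.χ₁_mul D.χ₂_e₂
    D.χ₂_e₁ D.χ₁_e₂ D.χ₁_e₁ fun r h h' => D.nil r h' h

/-- The first indecomposable projective. -/
abbrev P₁ : Submodule R R := idemIdeal R D.e₁

/-- The second indecomposable projective. -/
abbrev P₂ : Submodule R R := idemIdeal R D.e₂

/-- The generator of the first indecomposable projective. -/
abbrev gen₁ : D.P₁ := idemGen D.idem₁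

/-- The generator of the second indecomposable projective. -/
abbrev gen₂ : D.P₂ := idemGen D.idem₂

theorem χ₂_P₁ (r : D.P₁) : D.χ₂ r = 0 := by
  rw [← r.2, D.χ₂_mul, D.χ₂_e₁, mul_zero]

theorem e₂_mul_map {a b : ℕ} (f : (Fin b → D.P₂) →ₗ[R] (Fin a → D.P₁)) (k : Fin b) (i : Fin a) :
    D.e₂ * (f (Pi.single k D.gen₂) i : R) = f (Pi.single k D.gen₂) i := by
  have : D.e₂ • (Pi.single k D.gen₂ : Fin b → D.P₂) = Pi.single k D.gen₂ := by
    rw [← Pi.single_smul]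
    exact congrArg _ (smul_idemGen D.idem₂ D.gen₂)
  have h := congrArg (fun y : Fin a → D.P₁ => (y i : R)) (congrArg f this)
  simpa using h

theorem χ₁_map {a b : ℕ} (f : (Fin b → D.P₂) →ₗ[R] (Fin a → D.P₁)) (k : Fin b) (i : Fin a) :
    D.χ₁ (f (Pi.single k D.gen₂) i) = 0 := by
  rw [← D.e₂_mul_map, D.χ₁_mul, D.χ₁_e₂, zero_mul]

/-- The matrix of a map `P₂ᵇ → P₁ᵃ` with respect to the `l`-th arrow. -/
def arrowMatrix {a b : ℕ} (f : (Fin b → D.P₂) →ₗ[R] (Fin a → D.P₁)) (l : Fin 2) :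
    Matrix (Fin b) (Fin a) K :=
  Matrix.of fun k i => D.c l (f (Pi.single k D.gen₂) i)

theorem exists_arrowMatrix_eq {a b : ℕ} (T : Fin 2 → Matrix (Fin b) (Fin a) K) :
    ∃ h : (Fin b → D.P₂) →ₗ[R] (Fin a → D.P₁), D.arrowMatrix h = T := by
  choose x hx hxc using D.c_surj
  have hmem : ∀ y, x y ∈ idemIdeal R D.e₁ := fun y => by
    rw [mem_idemIdeal]
    conv_lhs => rw [← hx y]
    rw [mul_assoc, D.idem₁, hx]
  have he : ∀ y, D.e₂ * x y = x y := fun y => by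
    conv_lhs => rw [← hx y]
    rw [← mul_assoc, ← mul_assoc, D.idem₂, hx]
  let w : Fin b → Fin a → D.P₁ := fun k i => ⟨x fun l => T l k i, hmem _⟩
  refine ⟨∑ k, (idemHom D.e₂ (w k)).comp (LinearMap.proj k), ?_⟩
  ext l k i
  have : (∑ k, (idemHom D.e₂ (w k)).comp (LinearMap.proj k)) (Pi.single k D.gen₂) = w k := by
    rw [LinearMap.sum_apply, Finset.sum_eq_single k]
    · ext i
      simpa [idemGen, w] using he _
    · intro k' _ hk'
      simp [Pi.single_eq_of_ne hk']
    · simp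
  simp only [arrowMatrix, Matrix.of_apply, this]
  simp only [w, hxc]

theorem count_le {a b a' b' : ℕ} {f : (Fin b → D.P₂) →ₗ[R] (Fin a → D.P₁)}
    {g : (Fin b' → D.P₂) →ₗ[R] (Fin a' → D.P₁)} (h : ExtVanish f g) :
    2 * (b * a') ≤ a * a' + b * b' := by
  let Φ : (Matrix (Fin a) (Fin a') K × Matrix (Fin b) (Fin b') K) →ₗ[K]
      (Fin 2 → Matrix (Fin b) (Fin a') K) :=
    { toFun := fun p l => D.arrowMatrix f l * p.1 + p.2 * D.arrowMatrix g l
      map_add' := fun p q => by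
        ext l : 1
        simp only [Prod.fst_add, Prod.snd_add, Matrix.mul_add, Matrix.add_mul, Pi.add_apply]
        abel
      map_smul' := fun t p => by
        ext l : 1
        simp }
  have hΦ : Function.Surjective Φ := by
    intro T
    obtain ⟨t, rfl⟩ := D.exists_arrowMatrix_eq T
    obtain ⟨u, v, huv⟩ := h t
    refine ⟨(Matrix.of fun j i => D.χ₁ (u (Pi.single j D.gen₁) i),
      Matrix.of fun k k' => D.χ₂ (v (Pi.single k D.gen₂) k')), ?_⟩
    ext l k i
    have h0 := congrArg (fun y : Fin a' → D.P₁ => D.c l (y i)) (huv (Pi.single k D.gen₂))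
    rw [pi_map_eq_sum D.idem₁ u, pi_map_eq_sum D.idem₂ g] at h0
    simp only [Pi.add_apply, Finset.sum_apply, Pi.smul_apply, Submodule.coe_add,
      AddSubmonoidClass.coe_finsetSum, SetLike.val_smul, smul_eq_mul, map_add, map_sum, D.c_mul,
      D.χ₂_P₁, D.χ₁_map, zero_mul, mul_zero, zero_add, add_zero] at h0
    simp only [Φ, LinearMap.coe_mk, AddHom.coe_mk, Matrix.add_apply, Matrix.mul_apply,
      arrowMatrix, Matrix.of_apply]
    exact h0.symm
  have := LinearMap.finrank_le_finrank_of_surjective hΦ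
  simpa [Module.finrank_prod, Module.finrank_matrix, Module.finrank_pi_fintype] using this

end TwoArrowData
/-! ### Universal extensions of two-term complexes -/

section Extension

variable {R : Type} [Ring R] {Q₁ Q₀ P : Type} [AddCommGroup Q₁] [AddCommGroup Q₀]
  [AddCommGroup P] [Module R Q₁] [Module R Q₀] [Module R P]

/-- The complex `fᵏ` extended by `φ : P → Q₀ᵏ`. -/
def powExtend (f : Q₁ →ₗ[R] Q₀) {k : ℕ} (φ : Fin k → P →ₗ[R] Q₀) :
    (Fin k → Q₁) × P →ₗ[R] (Fin k → Q₀) :=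
  LinearMap.pi fun i => LinearMap.coprod (f.comp (LinearMap.proj i)) (φ i)

@[simp]
theorem powExtend_apply (f : Q₁ →ₗ[R] Q₀) {k : ℕ} (φ : Fin k → P →ₗ[R] Q₀)
    (x : (Fin k → Q₁) × P) (i : Fin k) : powExtend f φ x i = f (x.1 i) + φ i x.2 := rfl

theorem ExtVanish.powExtend_right {A₁ A₀ : Type} [AddCommGroup A₁] [AddCommGroup A₀] [Module R A₁]
    [Module R A₀] {g : A₁ →ₗ[R] A₀} {f : Q₁ →ₗ[R] Q₀} (h : ExtVanish g f) {k : ℕ}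
    (φ : Fin k → P →ₗ[R] Q₀) : ExtVanish g (powExtend f φ) := by
  intro t
  choose u v huv using fun i => h ((LinearMap.proj i).comp t)
  refine ⟨LinearMap.pi u, (LinearMap.inl R _ _).comp (LinearMap.pi v), fun x => ?_⟩
  ext i
  simpa using huv i x

/-- The maps `φ` span `Hom(P, coker f)` over the endomorphisms of the complex `f`. -/
def SpansHom (f : Q₁ →ₗ[R] Q₀) {k : ℕ} (φ : Fin k → P →ₗ[R] Q₀) : Prop :=
  ∀ t : P →ₗ[R] Q₀, ∃ (c₀ : Fin k → Q₀ →ₗ[R] Q₀) (c₁ : Fin k → Q₁ →ₗ[R] Q₁) (w : P →ₗ[R] Q₁),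
    (∀ i x, f (c₁ i x) = c₀ i (f x)) ∧ ∀ x, t x = ∑ i, c₀ i (φ i x) + f (w x)

theorem ExtVanish.powExtend_left {f : Q₁ →ₗ[R] Q₀} (h : ExtVanish f f) {k : ℕ}
    {φ : Fin k → P →ₗ[R] Q₀} (hφ : SpansHom f φ) : ExtVanish (powExtend f φ) f := by
  intro t
  choose u v huv using fun i =>
    h ((t.comp (LinearMap.inl R _ P)).comp (LinearMap.single R (fun _ : Fin k => Q₁) i))
  obtain ⟨c₀, c₁, w, hf, hw⟩ := hφ (t.comp (LinearMap.inr R (Fin k → Q₁) P) - ∑ i, (u i).comp (φ i))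
  refine ⟨∑ i, (u i + c₀ i).comp (LinearMap.proj i),
    LinearMap.coprod (∑ i, (v i - c₁ i).comp (LinearMap.proj i)) w, fun x => ?_⟩
  have h1 : t x = ∑ i, t (Pi.single i (x.1 i), 0) + t (0, x.2) := by
    have : x = ∑ i, ((Pi.single i (x.1 i), 0) : (Fin k → Q₁) × P) + (0, x.2) := by
      ext
      · simp [Prod.fst_sum, Finset.sum_apply]
      · simp [Prod.snd_sum]
    conv_lhs => rw [this]
    rw [map_add, map_sum]
  have h2 := hw x.2
  have h3 : ∀ i, t (Pi.single i (x.1 i), 0) = u i (f (x.1 i)) + f (v i (x.1 i)) :=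
    fun i => huv i (x.1 i)
  simp only [LinearMap.sub_apply, LinearMap.comp_apply, LinearMap.inr_apply,
    LinearMap.sum_apply, sub_eq_iff_eq_add] at h2
  rw [h1, h2]
  simp only [h3, LinearMap.sum_apply, LinearMap.comp_apply, LinearMap.add_apply,
    LinearMap.sub_apply, LinearMap.coprod_apply,
    LinearMap.proj_apply, powExtend_apply, map_add, map_sub, map_sum, hf,
    Finset.sum_add_distrib, Finset.sum_sub_distrib]
  abel

end Extension

/-! ### Splitting two-term complexes -/

theorem projective_pi_idemIdeal {R : Type} [Ring R] {e : R} (he : e * e = e) (ι : Type)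
    [Fintype ι] [DecidableEq ι] : Module.Projective R (ι → idemIdeal R e) :=
  have := projective_idemIdeal he
  Module.Projective.of_equiv' (DirectSum.linearEquivFunOnFintype R ι fun _ => idemIdeal R e)

theorem IsLocalIdem.exists_equiv_pi_of_isCompl {K R : Type} [Field K] [Ring R] [Algebra K R]
    [FiniteDimensional K R] {e : R} (h : IsLocalIdem R e) {a : ℕ}
    {A B : Submodule R (Fin a → idemIdeal R e)} (hc : IsCompl A B) :
    ∃ a₁ a₂ : ℕ, a₁ + a₂ = a ∧ Nonempty (A ≃ₗ[R] (Fin a₁ → idemIdeal R e)) ∧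
      Nonempty (B ≃ₗ[R] (Fin a₂ → idemIdeal R e)) := by
  have := projective_pi_idemIdeal h.idem (Fin a)
  have hP : FiniteDimensional K (idemIdeal R e) :=
    FiniteDimensional.finiteDimensional_submodule ((idemIdeal R e).restrictScalars K)
  have key : ∀ {A B : Submodule R (Fin a → idemIdeal R e)}, IsCompl A B →
      ∃ a₁ : ℕ, Nonempty (A ≃ₗ[R] (Fin a₁ → idemIdeal R e)) := by
    intro A B hc
    have : FiniteDimensional K A :=
      FiniteDimensional.finiteDimensional_submodule (A.restrictScalars K)
    let ρ := A.projectionOnto B hc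
    have hρ : ρ.comp A.subtype = LinearMap.id := by
      ext x
      simp [ρ]
    have : Module.Projective R A := Module.Projective.of_split _ _ hρ
    refine h.exists_equiv_pi (K := K) _ A rfl ?_
    have hgen : Submodule.span R {q : Fin a → idemIdeal R e | e • q = q} = ⊤ := by
      rw [eq_top_iff]
      intro p _
      have := pi_map_eq_sum h.idem (LinearMap.id : (Fin a → idemIdeal R e) →ₗ[R] _) p
      rw [LinearMap.id_apply] at this
      rw [this]
      refine Submodule.sum_mem _ fun i _ => Submodule.smul_mem _ _ (Submodule.subset_span ?_)
      change e • (Pi.single i (idemGen h.idem) : Fin a → idemIdeal R e) = _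
      rw [← Pi.single_smul]
      exact congrArg _ (smul_idemGen h.idem (idemGen h.idem))
    have hsurj : Function.Surjective ρ := fun x => ⟨x, LinearMap.congr_fun hρ x⟩
    rw [eq_top_iff, ← LinearMap.range_eq_top.2 hsurj, LinearMap.range_eq_map, ← hgen,
      Submodule.map_span]
    apply Submodule.span_mono
    rintro _ ⟨x, hx, rfl⟩
    change e • ρ x = ρ x
    rw [← map_smul]
    exact congrArg ρ hx
  obtain ⟨a₁, ⟨E₁⟩⟩ := key hc
  obtain ⟨a₂, ⟨E₂⟩⟩ := key hc.symm
  refine ⟨a₁, a₂, ?_, ⟨E₁⟩, ⟨E₂⟩⟩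
  have hd := (((A.prodEquivOfIsCompl B hc).symm.trans
    (E₁.prodCongr E₂)).restrictScalars K).finrank_eq
  have hpos : 0 < Module.finrank K (idemIdeal R e) := by
    have := h.isIndecModule.1
    exact Module.finrank_pos
  simp only [Module.finrank_prod, Module.finrank_pi_fintype, Finset.sum_const, Finset.card_univ,
    Fintype.card_fin, smul_eq_mul, ← add_mul] at hd
  exact (Nat.eq_of_mul_eq_mul_right hpos hd).symm

theorem IsRetract.congr {R : Type} [Ring R] {Q₁ Q₀ A₁ A₀ B₁ B₀ : Type} [AddCommGroup Q₁]
    [AddCommGroup Q₀] [AddCommGroup A₁] [AddCommGroup A₀] [AddCommGroup B₁] [AddCommGroup B₀]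
    [Module R Q₁] [Module R Q₀] [Module R A₁] [Module R A₀] [Module R B₁] [Module R B₀]
    {f : Q₁ →ₗ[R] Q₀} {g : A₁ →ₗ[R] A₀} {i₁ : A₁ →ₗ[R] Q₁} {i₀ : A₀ →ₗ[R] Q₀}
    {r₁ : Q₁ →ₗ[R] A₁} {r₀ : Q₀ →ₗ[R] A₀} (h : IsRetract g f i₁ i₀ r₁ r₀)
    (E₁ : A₁ ≃ₗ[R] B₁) (E₀ : A₀ ≃ₗ[R] B₀) :
    IsRetract ((E₀.toLinearMap.comp g).comp E₁.symm.toLinearMap) f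
      (i₁.comp E₁.symm.toLinearMap) (i₀.comp E₀.symm.toLinearMap)
      (E₁.toLinearMap.comp r₁) (E₀.toLinearMap.comp r₀) where
  map_incl x := by simp [h.map_incl]
  map_retr x := by simp [h.map_retr]
  retr_incl₁ x := by simp [h.retr_incl₁]
  retr_incl₀ x := by simp [h.retr_incl₀]

theorem IsRetract.refl {R : Type} [Ring R] {Q₁ Q₀ : Type} [AddCommGroup Q₁] [AddCommGroup Q₀]
    [Module R Q₁] [Module R Q₀] (f : Q₁ →ₗ[R] Q₀) :
    IsRetract f f LinearMap.id LinearMap.id LinearMap.id LinearMap.id :=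
  ⟨fun _ => rfl, fun _ => rfl, fun _ => rfl, fun _ => rfl⟩

theorem isRetract_of_isCompl {R : Type} [Ring R] {Q₁ Q₀ : Type} [AddCommGroup Q₁]
    [AddCommGroup Q₀] [Module R Q₁] [Module R Q₀] {f : Q₁ →ₗ[R] Q₀} {A B : Submodule R Q₁}
    {A' B' : Submodule R Q₀} (hc : IsCompl A B) (hc' : IsCompl A' B')
    (hA : ∀ x ∈ A, f x ∈ A') (hB : ∀ x ∈ B, f x ∈ B') :
    IsRetract (f.restrict hA) f A.subtype A'.subtype (A.projectionOnto B hc)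
      (A'.projectionOnto B' hc') where
  map_incl x := rfl
  map_retr x := by
    obtain ⟨y, hy, z, hz, rfl⟩ := Submodule.mem_sup.1 (hc.sup_eq_top.ge (trivial : x ∈ ⊤))
    have h1 : A.projectionOnto B hc (y + z) = ⟨y, hy⟩ := by
      rw [map_add, (Submodule.projectionOnto_apply_eq_zero_iff hc).2 hz, add_zero]
      exact Submodule.projectionOnto_apply_left hc ⟨y, hy⟩
    have h2 : A'.projectionOnto B' hc' (f y + f z) = ⟨f y, hA y hy⟩ := by
      rw [map_add, (Submodule.projectionOnto_apply_eq_zero_iff hc').2 (hB z hz), add_zero]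
      exact Submodule.projectionOnto_apply_left hc' ⟨f y, hA y hy⟩
    rw [h1, map_add, h2]
    rfl
  retr_incl₁ x := by simp
  retr_incl₀ x := by simp
theorem exists_isCompl_of_not_isIndecModule {R : Type} [Ring R] {Q₁ Q₀ : Type} [AddCommGroup Q₁]
    [AddCommGroup Q₀] [Module R Q₁] [Module R Q₀] [Module.Projective R Q₁]
    [Module.Projective R Q₀] [IsNoetherian R Q₁] [IsArtinian R Q₁] [IsNoetherian R Q₀]
    [IsArtinian R Q₀] (f : Q₁ →ₗ[R] Q₀) (hnt : Nontrivial (Q₀ ⧸ LinearMap.range f))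
    (h : ¬ IsIndecModule R (Q₀ ⧸ LinearMap.range f)) :
    ∃ (A B : Submodule R Q₁) (A' B' : Submodule R Q₀), IsCompl A B ∧ IsCompl A' B' ∧
      (∀ x ∈ A, f x ∈ A') ∧ (∀ x ∈ B, f x ∈ B') ∧ A' ≠ ⊥ ∧ B' ≠ ⊥ := by
  unfold IsIndecModule at h
  push Not at h
  obtain ⟨N₁, N₂, hc, h₁, h₂⟩ := h hnt
  set q := (LinearMap.range f).mkQ with hq
  have hqs : Function.Surjective q := Submodule.mkQ_surjective _
  have hqf : ∀ x, q (f x) = 0 := fun x => by simp [hq]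
  let p := N₁.projection N₂ hc
  obtain ⟨u, hu⟩ := Module.projective_lifting_property q (p.comp q) hqs
  have hu' : ∀ x, q (u x) = p (q x) := fun x => LinearMap.congr_fun hu x
  obtain ⟨v, hv⟩ := Module.projective_lifting_property f.rangeRestrict
    ((u.comp f).codRestrict (LinearMap.range f) fun x => by
      rw [← Submodule.Quotient.mk_eq_zero]
      change q (u (f x)) = 0
      rw [hu', hqf, map_zero]) f.surjective_rangeRestrict
  have hv' : ∀ x, f (v x) = u (f x) := fun x =>
    congrArg Subtype.val (LinearMap.congr_fun hv x)
  have hpow : ∀ n x, f ((v ^ n) x) = (u ^ n) (f x) := by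
    intro n
    induction n with
    | zero => intro x; rfl
    | succ n ih => intro x; rw [pow_succ, pow_succ, Module.End.mul_apply, Module.End.mul_apply,
        ih, hv']
  have hpp : ∀ x, p (p x) = p x := fun x =>
    Submodule.projection_apply_of_mem_left hc (Submodule.projection_apply_mem hc x)
  have hqpow : ∀ n x, q ((u ^ (n + 1)) x) = p (q x) := by
    intro n
    induction n with
    | zero => intro x; simpa using hu' x
    | succ n ih => intro x; rw [pow_succ, Module.End.mul_apply, ih, hu', hpp]
  obtain ⟨n, hnv, hnu⟩ := ((Filter.tendsto_add_atTop_nat 1).eventually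
    (v.eventually_isCompl_ker_pow_range_pow.and u.eventually_isCompl_ker_pow_range_pow)).exists
  refine ⟨_, _, _, _, hnv, hnu, ?_, ?_, ?_, ?_⟩
  · intro x hx
    rw [LinearMap.mem_ker] at *
    rw [← hpow, hx, map_zero]
  · rintro _ ⟨x, rfl⟩
    exact ⟨f x, (hpow _ x).symm⟩
  · intro hbot
    rw [hbot] at hnu
    have hr : LinearMap.range (u ^ (n + 1)) = ⊤ := by simpa using hnu.sup_eq_top
    apply h₂
    rw [eq_bot_iff]
    intro y hy
    obtain ⟨x, rfl⟩ := hqs y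
    obtain ⟨z, rfl⟩ := LinearMap.range_eq_top.1 hr x
    rw [hqpow] at hy ⊢
    exact hc.disjoint.le_bot ⟨Submodule.projection_apply_mem hc _, hy⟩
  · intro hbot
    apply h₁
    rw [eq_bot_iff]
    intro y hy
    obtain ⟨x, rfl⟩ := hqs y
    have h0 : (u ^ (n + 1)) x = 0 := by
      have : (u ^ (n + 1)) x ∈ LinearMap.range (u ^ (n + 1)) := ⟨x, rfl⟩
      rwa [hbot] at this
    have := hqpow n x
    rw [h0, map_zero, Submodule.projection_apply_of_mem_left hc hy] at this
    exact this.symm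

namespace TwoArrowData

variable {K R : Type} [Field K] [Ring R] [Algebra K R] [FiniteDimensional K R]
  (D : TwoArrowData K R)

theorem exists_split {a b : ℕ} (g : (Fin b → D.P₂) →ₗ[R] (Fin a → D.P₁))
    (hnt : Nontrivial ((Fin a → D.P₁) ⧸ LinearMap.range g))
    (h : ¬ IsIndecModule R ((Fin a → D.P₁) ⧸ LinearMap.range g)) :
    ∃ a₁ a₂ b₁ b₂ : ℕ, a₁ + a₂ = a ∧ b₁ + b₂ = b ∧ 0 < a₁ ∧ 0 < a₂ ∧
      (∃ (g₁ : (Fin b₁ → D.P₂) →ₗ[R] (Fin a₁ → D.P₁)), ∃ i₁ i₀ r₁ r₀,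
        IsRetract g₁ g i₁ i₀ r₁ r₀) ∧
      (∃ (g₂ : (Fin b₂ → D.P₂) →ₗ[R] (Fin a₂ → D.P₁)), ∃ i₁ i₀ r₁ r₀,
        IsRetract g₂ g i₁ i₀ r₁ r₀) := by
  have : IsNoetherianRing R := isNoetherian_of_tower K inferInstance
  have : IsArtinianRing R := isArtinian_of_tower K inferInstance
  have := projective_pi_idemIdeal D.idem₁ (Fin a)
  have := projective_pi_idemIdeal D.idem₂ (Fin b)
  obtain ⟨A, B, A', B', hc, hc', hA, hB, hA', hB'⟩ :=
    exists_isCompl_of_not_isIndecModule g hnt h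
  obtain ⟨a₁, a₂, ha, ⟨E₁⟩, ⟨E₂⟩⟩ := D.isLocalIdem₁.exists_equiv_pi_of_isCompl (K := K) hc'
  obtain ⟨b₁, b₂, hb, ⟨F₁⟩, ⟨F₂⟩⟩ := D.isLocalIdem₂.exists_equiv_pi_of_isCompl (K := K) hc
  have hpos : ∀ {a₁ : ℕ} {A' : Submodule R (Fin a → D.P₁)}, A' ≠ ⊥ →
      (A' ≃ₗ[R] (Fin a₁ → D.P₁)) → 0 < a₁ := by
    intro a₁ A' hA' E
    rcases Nat.eq_zero_or_pos a₁ with rfl | h0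
    · exact absurd ((Submodule.subsingleton_iff_eq_bot).1 E.toEquiv.subsingleton) hA'
    · exact h0
  exact ⟨a₁, a₂, b₁, b₂, ha, hb, hpos hA' E₁, hpos hB' E₂,
    ⟨_, _, _, _, _, (isRetract_of_isCompl hc hc' hA hB).congr F₁ E₁⟩,
    ⟨_, _, _, _, _, (isRetract_of_isCompl hc.symm hc'.symm hB hA).congr F₂ E₂⟩⟩

end TwoArrowData
/-! ### Homomorphisms into the first simple module -/

namespace TwoArrowData

section Simple

variable {K R : Type} [Field K] [Ring R] [Algebra K R] (D : TwoArrowData K R)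

/-- The character `χ₁` as a ring homomorphism. -/
def χ₁Hom : R →+* K where
  toFun := D.χ₁
  map_one' := by rw [← D.sum, map_add, D.χ₁_e₁, D.χ₁_e₂, add_zero]
  map_mul' := D.χ₁_mul
  map_zero' := map_zero _
  map_add' := map_add _

/-- The first simple module. -/
def Simple₁ (_ : TwoArrowData K R) : Type := K

instance : AddCommGroup D.Simple₁ := inferInstanceAs (AddCommGroup K)
instance : Module K D.Simple₁ := inferInstanceAs (Module K K)
instance : FiniteDimensional K D.Simple₁ := inferInstanceAs (FiniteDimensional K K)
instance : Module R D.Simple₁ := Module.compHom K D.χ₁Hom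

theorem smul_simple₁ (r : R) (x : D.Simple₁) : r • x = D.χ₁ r • x := rfl

instance : IsScalarTower K R D.Simple₁ :=
  ⟨fun t r x => by rw [smul_simple₁, smul_simple₁, map_smul, smul_assoc]⟩

theorem finrank_idemPart_simple₁ : Module.finrank K (idemPart K D.e₁ D.Simple₁) = 1 := by
  have : idemPart K D.e₁ D.Simple₁ = ⊤ := by
    rw [eq_top_iff]
    intro x _
    change D.e₁ • x = x
    rw [smul_simple₁, D.χ₁_e₁, one_smul]
  rw [this, finrank_top]
  exact Module.finrank_self K

theorem finrank_idemPart_simple₁' : Module.finrank K (idemPart K D.e₂ D.Simple₁) = 0 := by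
  have : idemPart K D.e₂ D.Simple₁ = ⊥ := by
    rw [eq_bot_iff]
    intro x hx
    change D.e₂ • x = x at hx
    rw [smul_simple₁, D.χ₁_e₂, zero_smul] at hx
    exact hx.symm
  rw [this, finrank_bot]

theorem finrank_coker_hom_simple₁ {a b : ℕ} (f : (Fin b → D.P₂) →ₗ[R] (Fin a → D.P₁)) :
    Module.finrank K (((Fin a → D.P₁) ⧸ LinearMap.range f) →ₗ[R] D.Simple₁) = a := by
  have := finiteDimensional_pi_hom (K := K) (N := D.Simple₁) D.idem₁ (Fin a)
  have := finiteDimensional_pi_hom (K := K) (N := D.Simple₁) D.idem₂ (Fin b)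
  have h0 := finrank_pi_hom (K := K) (N := D.Simple₁) D.idem₂ b
  rw [finrank_idemPart_simple₁', mul_zero] at h0
  have hsub := Module.finrank_zero_iff.1 h0
  have := finrank_hom_coker (K := K) (N := D.Simple₁) f
    fun h => ⟨0, Subsingleton.elim _ _⟩
  rwa [h0, finrank_pi_hom D.idem₁, finrank_idemPart_simple₁, mul_one, add_zero] at this

theorem nontrivial_coker {a b : ℕ} (ha : 0 < a) (f : (Fin b → D.P₂) →ₗ[R] (Fin a → D.P₁)) :
    Nontrivial ((Fin a → D.P₁) ⧸ LinearMap.range f) := by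
  by_contra h
  rw [not_nontrivial_iff_subsingleton] at h
  have := D.finrank_coker_hom_simple₁ f
  rw [Module.finrank_zero_of_subsingleton] at this
  omega

end Simple

end TwoArrowData

theorem exists_minimal_nat {p : ℕ → Prop} (h : ∃ n, p n) : ∃ n, p n ∧ ∀ m < n, ¬ p m := by
  classical
  exact ⟨Nat.find h, Nat.find_spec h, fun _ => Nat.find_min h⟩

theorem IsIndecModule.congr {R : Type} [Ring R] {M N : Type} [AddCommGroup M] [AddCommGroup N]
    [Module R M] [Module R N] (E : M ≃ₗ[R] N) (h : IsIndecModule R M) : IsIndecModule R N := by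
  have := h.1
  refine ⟨E.symm.toEquiv.nontrivial, fun N₁ N₂ hc => ?_⟩
  have := h.2 _ _ ((Submodule.orderIsoMapComap E).symm.isCompl hc)
  simpa only [map_eq_bot_iff] using this

/-! ### Mutation of rigid two-term complexes -/

theorem nonempty_pow_equiv {R : Type} [Ring R] (k a : ℕ) (M : Type) [AddCommGroup M] [Module R M] :
    Nonempty ((Fin k → Fin a → M) ≃ₗ[R] (Fin (k * a) → M)) :=
  ⟨(LinearEquiv.curry R M (Fin k) (Fin a)).symm.trans
    (LinearEquiv.funCongrLeft R M finProdFinEquiv.symm)⟩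

theorem nonempty_prod_equiv {R : Type} [Ring R] (k : ℕ) (M : Type) [AddCommGroup M] [Module R M] :
    Nonempty (((Fin k → M) × M) ≃ₗ[R] (Fin (k + 1) → M)) :=
  ⟨(LinearEquiv.prodComm R _ _).trans (Fin.consLinearEquiv R fun _ : Fin (k + 1) => M)⟩

namespace TwoArrowData

variable {K R : Type} [Field K] [Ring R] [Algebra K R]
  (D : TwoArrowData K R)

/-- The numerical types of indecomposable rigid two-term complexes `P₂ᵇ → P₁ᵃ` with `b < a`. -/
def IsRigidType (a b : ℕ) : Prop :=
  b < a ∧ ∃ f : (Fin b → D.P₂) →ₗ[R] (Fin a → D.P₁),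
    ExtVanish f f ∧ IsIndecModule R ((Fin a → D.P₁) ⧸ LinearMap.range f)

theorem isRigidType_one_zero : D.IsRigidType 1 0 := by
  refine ⟨one_pos, 0, fun h => ⟨0, 0, fun x => ?_⟩, D.isLocalIdem₁.isIndecModule.congr ?_⟩
  · rw [Subsingleton.elim x 0, map_zero]
    simp
  · exact (LinearEquiv.funUnique (Fin 1) R D.P₁).symm.trans
      (Submodule.quotEquivOfEqBot _ LinearMap.range_zero).symm

variable [FiniteDimensional K R]

theorem finiteDimensional_quotient {a : ℕ} (N : Submodule R (Fin a → D.P₁)) :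
    FiniteDimensional K ((Fin a → D.P₁) ⧸ N) := by
  have : FiniteDimensional K D.P₁ :=
    FiniteDimensional.finiteDimensional_submodule (D.P₁.restrictScalars K)
  exact Module.Finite.of_surjective (N.mkQ.restrictScalars K) (Submodule.mkQ_surjective N)

/-- A basis of `Hom(P₂, coker f)`, lifted to maps `P₂ → P₁ᵃ`. -/
theorem exists_lift_basis {a b : ℕ} (f : (Fin b → D.P₂) →ₗ[R] (Fin a → D.P₁)) :
    ∃ φ : Fin (Module.finrank K (idemPart K D.e₂ ((Fin a → D.P₁) ⧸ LinearMap.range f))) →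
        D.P₂ →ₗ[R] (Fin a → D.P₁), SpansHom f φ := by
  have := D.finiteDimensional_quotient (LinearMap.range f)
  have := projective_idemIdeal D.idem₂
  let X := (Fin a → D.P₁) ⧸ LinearMap.range f
  let β := (Module.finBasis K (idemPart K D.e₂ X)).map (idemHomEquiv K X D.idem₂).symm
  choose φ hφ using fun i => Module.projective_lifting_property (LinearMap.range f).mkQ (β i)
    (Submodule.mkQ_surjective _)
  refine ⟨φ, fun t => ?_⟩
  let c := β.repr ((LinearMap.range f).mkQ.comp t)
  have hc : ∀ x, (LinearMap.range f).mkQ (t x) = ∑ i, c i • (LinearMap.range f).mkQ (φ i x) := by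
    intro x
    have h1 := LinearMap.congr_fun (β.sum_repr ((LinearMap.range f).mkQ.comp t)) x
    rw [LinearMap.sum_apply] at h1
    rw [← LinearMap.comp_apply, ← h1]
    refine Finset.sum_congr rfl fun i _ => ?_
    rw [LinearMap.smul_apply, ← hφ i]
    rfl
  obtain ⟨w, hw⟩ := Module.projective_lifting_property f.rangeRestrict
    ((t - ∑ i, c i • φ i).codRestrict (LinearMap.range f) fun x => by
      rw [← Submodule.Quotient.mk_eq_zero, ← Submodule.mkQ_apply, LinearMap.sub_apply, map_sub,
        hc, LinearMap.sum_apply, map_sum, sub_eq_zero]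
      rfl) f.surjective_rangeRestrict
  refine ⟨fun i => c i • LinearMap.id, fun i => c i • LinearMap.id, w,
    fun i x => f.map_smul_of_tower (c i) x, fun x => ?_⟩
  have h2 : f (w x) = t x - (∑ i, c i • φ i) x :=
    congrArg Subtype.val (LinearMap.congr_fun hw x)
  rw [h2, LinearMap.sum_apply]
  simp only [LinearMap.smul_apply, LinearMap.id_apply]
  abel

theorem exists_extension {a b : ℕ} (hba : b < a) (f : (Fin b → D.P₂) →ₗ[R] (Fin a → D.P₁))
    (hf : ExtVanish f f) :
    0 < Module.finrank K (idemPart K D.e₂ ((Fin a → D.P₁) ⧸ LinearMap.range f)) ∧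
    ∃ (a' b' : ℕ) (f' : (Fin b' → D.P₂) →ₗ[R] (Fin a' → D.P₁)),
      ExtVanish f f' ∧ ExtVanish f' f ∧ ExtVanish f' f' ∧ b * a' < b' * a := by
  obtain ⟨φ, hφ⟩ := D.exists_lift_basis f
  generalize Module.finrank K (idemPart K D.e₂ ((Fin a → D.P₁) ⧸ LinearMap.range f)) = k at φ hφ ⊢
  have h₁ := hf.powExtend_left hφ
  have h₂ := hf.powExtend_right φ
  have h₃ := h₁.powExtend_right φ
  obtain ⟨E₀⟩ := nonempty_pow_equiv (R := R) k a D.P₁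
  obtain ⟨E₂⟩ := nonempty_pow_equiv (R := R) k b D.P₂
  obtain ⟨E₁⟩ := nonempty_prod_equiv (R := R) (k * b) D.P₂
  have hr := (IsRetract.refl (powExtend f φ)).congr
    ((E₂.prodCongr (LinearEquiv.refl R D.P₂)).trans E₁) E₀
  have hcount := D.count_le (h₁.retract_left hr)
  refine ⟨Nat.pos_of_ne_zero ?_, _, _, _, h₂.retract_right hr,
    h₁.retract_left hr, (h₃.retract_right hr).retract_left hr, ?_⟩
  · rintro rfl
    omega
  · have : b * (k * a) = k * b * a := by ring
    rw [this, add_mul]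
    omega

theorem exists_isIndecModule_extension {a b : ℕ} (hba : b < a)
    (f : (Fin b → D.P₂) →ₗ[R] (Fin a → D.P₁)) (hf : ExtVanish f f) :
    ∃ (a' b' : ℕ) (f' : (Fin b' → D.P₂) →ₗ[R] (Fin a' → D.P₁)),
      ExtVanish f f' ∧ ExtVanish f' f ∧ ExtVanish f' f' ∧ b * a' < b' * a ∧ b' < a' ∧
        IsIndecModule R ((Fin a' → D.P₁) ⧸ LinearMap.range f') := by
  have hex := (D.exists_extension hba f hf).2
  obtain ⟨a', ⟨b', f', h₁, h₂, h₃, hs⟩, hmin⟩ := exists_minimal_nat hex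
  have hlt : b' < a' := by
    by_contra! hle
    have hcount := D.count_le h₂
    nlinarith [Nat.mul_le_mul hle hba.le]
  refine ⟨a', b', f', h₁, h₂, h₃, hs, hlt, ?_⟩
  by_contra hind
  obtain ⟨a₁, a₂, b₁, b₂, ha, hb, h₁', h₂', ⟨g₁, i₁, i₀, r₁, r₀, hr⟩,
    ⟨g₂, j₁, j₀, s₁, s₀, hr'⟩⟩ := D.exists_split f' (D.nontrivial_coker (by omega) f') hind
  by_cases hslope : b * a₁ < b₁ * a
  · exact hmin a₁ (by omega) ⟨b₁, g₁, h₁.retract_right hr,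
      h₂.retract_left hr, (h₃.retract_left hr).retract_right hr, hslope⟩
  · refine hmin a₂ (by omega) ⟨b₂, g₂, h₁.retract_right hr',
      h₂.retract_left hr', (h₃.retract_left hr').retract_right hr', ?_⟩
    rw [← ha, ← hb] at hs
    nlinarith

end TwoArrowData
/-! ### Support τ-tilting modules with two summands -/

theorem hasIndecClassCount_two {R : Type} [Ring R] {M : Type} [AddCommGroup M] [Module R M]
    {A B : Submodule R M} (hc : IsCompl A B) (hA : IsIndecModule R A) (hB : IsIndecModule R B)
    (hAB : IsEmpty (A ≃ₗ[R] B)) :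
    HasIndecClassCount R (ModuleCat.of R M) 2 ∧ IsBasicModuleCat R (ModuleCat.of R M) := by
  have hinternal : DirectSum.IsInternal (![A, B] : Fin 2 → Submodule R M) := by
    rw [DirectSum.isInternal_submodule_iff_isCompl ![A, B] (i := 0) (j := 1) (by decide)
      (by ext i; fin_cases i <;> simp)]
    exact hc
  have hind : ∀ i, IsIndecModule R ((![A, B] : Fin 2 → Submodule R M) i) :=
    Fin.forall_fin_two.2 ⟨hA, hB⟩
  have hBA : IsEmpty (B ≃ₗ[R] A) := ⟨fun E => hAB.false E.symm⟩
  have hne : ∀ i j : Fin 2, i ≠ j → IsEmpty ((![A, B] : Fin 2 → Submodule R M) i ≃ₗ[R]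
      (![A, B] : Fin 2 → Submodule R M) j) :=
    Fin.forall_fin_two.2 ⟨Fin.forall_fin_two.2 ⟨fun h => (h rfl).elim, fun _ => hAB⟩,
      Fin.forall_fin_two.2 ⟨fun _ => hBA, fun h => (h rfl).elim⟩⟩
  refine ⟨⟨2, _, hinternal, hind, id, Function.surjective_id, fun i j => ⟨?_, fun ⟨E⟩ => ?_⟩⟩,
    2, _, hinternal, hind, hne⟩
  · rintro rfl
    exact ⟨LinearEquiv.refl R _⟩
  · by_contra hij
    exact (hne i j hij).false E

theorem hasIndecClassCount_zero (R : Type) [Ring R] :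
    HasIndecClassCount R (ModuleCat.of R PUnit.{1}) 0 := by
  refine ⟨0, Fin.elim0, ⟨fun x y _ => Subsingleton.elim x y, fun x => ⟨0, Subsingleton.elim _ _⟩⟩,
    fun i => i.elim0, id, Function.surjective_id, fun i => i.elim0⟩

theorem hasIndecClassCount_prod {R : Type} [Ring R] {M N : Type} [AddCommGroup M]
    [AddCommGroup N] [Module R M] [Module R N] (hM : IsIndecModule R M) (hN : IsIndecModule R N)
    (hMN : IsEmpty (M ≃ₗ[R] N)) :
    HasIndecClassCount R (ModuleCat.of R (M × N)) 2 ∧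
      IsBasicModuleCat R (ModuleCat.of R (M × N)) := by
  let E : M ≃ₗ[R] LinearMap.range (LinearMap.inl R M N) :=
    LinearEquiv.ofInjective _ LinearMap.inl_injective
  let F : N ≃ₗ[R] LinearMap.range (LinearMap.inr R M N) :=
    LinearEquiv.ofInjective _ LinearMap.inr_injective
  exact hasIndecClassCount_two LinearMap.isCompl_range_inl_inr (hM.congr E) (hN.congr F)
    ⟨fun G => hMN.false ((E.trans G).trans F.symm)⟩

theorem isTauRigidCat_prod {R : Type} [Ring R] {Q₁ Q₀ Q₁' Q₀' : Type} [AddCommGroup Q₁]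
    [AddCommGroup Q₀] [AddCommGroup Q₁'] [AddCommGroup Q₀'] [Module R Q₁] [Module R Q₀]
    [Module R Q₁'] [Module R Q₀'] [Module.Projective R Q₁] [Module.Projective R Q₀]
    [Module.Projective R Q₁'] [Module.Projective R Q₀'] [Module.Finite R Q₁]
    [Module.Finite R Q₀] [Module.Finite R Q₁'] [Module.Finite R Q₀']
    {f : Q₁ →ₗ[R] Q₀} {g : Q₁' →ₗ[R] Q₀'} (hff : ExtVanish f f) (hfg : ExtVanish f g)
    (hgf : ExtVanish g f) (hgg : ExtVanish g g) :
    IsTauRigidCat R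
      (ModuleCat.of R ((Q₀ ⧸ LinearMap.range f) × (Q₀' ⧸ LinearMap.range g))) := by
  refine ⟨inferInstanceAs (Module.Finite R ((Q₀ ⧸ LinearMap.range f) × (Q₀' ⧸ LinearMap.range g))),
    ModuleCat.of R (Q₁ × Q₁'), ModuleCat.of R (Q₀ × Q₀'), f.prodMap g,
    (LinearMap.range f).mkQ.prodMap (LinearMap.range g).mkQ,
    inferInstanceAs (Module.Finite R (Q₁ × Q₁')), inferInstanceAs (Module.Projective R (Q₁ × Q₁')),
    inferInstanceAs (Module.Finite R (Q₀ × Q₀')), inferInstanceAs (Module.Projective R (Q₀ × Q₀')),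
    ?_, ?_, fun h => ?_⟩
  · exact (Submodule.mkQ_surjective _).prodMap (Submodule.mkQ_surjective _)
  · rw [LinearMap.range_prodMap, LinearMap.ker_prodMap, Submodule.ker_mkQ, Submodule.ker_mkQ]
  · change (Q₁ × Q₁') →ₗ[R] ((Q₀ ⧸ LinearMap.range f) × (Q₀' ⧸ LinearMap.range g)) at h
    obtain ⟨t₁, h₁⟩ := hff.exists_factor
      (((LinearMap.fst R _ _).comp h).comp (LinearMap.inl R Q₁ Q₁'))
    obtain ⟨t₂, h₂⟩ := hfg.exists_factor
      (((LinearMap.snd R _ _).comp h).comp (LinearMap.inl R Q₁ Q₁'))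
    obtain ⟨t₃, h₃⟩ := hgf.exists_factor
      (((LinearMap.fst R _ _).comp h).comp (LinearMap.inr R Q₁ Q₁'))
    obtain ⟨t₄, h₄⟩ := hgg.exists_factor
      (((LinearMap.snd R _ _).comp h).comp (LinearMap.inr R Q₁ Q₁'))
    refine ⟨(t₁.coprod t₃).prod (t₂.coprod t₄), ?_⟩
    apply LinearMap.prod_ext
    · ext x
      · exact LinearMap.congr_fun h₁ x |>.trans (by simp)
      · exact LinearMap.congr_fun h₂ x |>.trans (by simp)
    · ext x
      · exact LinearMap.congr_fun h₃ x |>.trans (by simp)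
      · exact LinearMap.congr_fun h₄ x |>.trans (by simp)

namespace TwoArrowData

variable {K R : Type} [Field K] [Ring R] [Algebra K R] (D : TwoArrowData K R)

theorem isCompl_P₁_P₂ : IsCompl D.P₁ D.P₂ := by
  refine IsCompl.of_le (fun r ⟨h₁, h₂⟩ => ?_) fun r _ => ?_
  · have h₁' : r * D.e₁ = r := h₁
    have h₂' : r * D.e₂ = r := h₂
    rw [Submodule.mem_bot, ← h₂', ← h₁', mul_assoc, D.orth₁₂, mul_zero]
  · have : r = r * D.e₁ + r * D.e₂ := by rw [← mul_add, D.sum, mul_one]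
    rw [this]
    refine Submodule.add_mem_sup ?_ ?_
    · rw [mem_idemIdeal, mul_assoc, D.idem₁]
    · rw [mem_idemIdeal, mul_assoc, D.idem₂]

theorem isEmpty_equiv_P₁_P₂ : IsEmpty (D.P₁ ≃ₗ[R] D.P₂) := by
  refine ⟨fun E => ?_⟩
  have h := (E.congrLeft D.Simple₁ K).finrank_eq
  rw [(idemHomEquiv K D.Simple₁ D.idem₁).finrank_eq,
    (idemHomEquiv K D.Simple₁ D.idem₂).finrank_eq, finrank_idemPart_simple₁,
    finrank_idemPart_simple₁'] at h
  exact one_ne_zero h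

theorem hasIndecClassCount_self (D : TwoArrowData K R) : HasIndecClassCount R (ModuleCat.of R R) 2 :=
  (hasIndecClassCount_two D.isCompl_P₁_P₂ D.isLocalIdem₁.isIndecModule
    D.isLocalIdem₂.isIndecModule D.isEmpty_equiv_P₁_P₂).1

variable [FiniteDimensional K R]

theorem isEmpty_equiv_coker {a b a' b' : ℕ} (hba : b < a)
    {f : (Fin b → D.P₂) →ₗ[R] (Fin a → D.P₁)} {f' : (Fin b' → D.P₂) →ₗ[R] (Fin a' → D.P₁)}
    (hff : ExtVanish f f) (hf'f : ExtVanish f' f) (hs : b * a' < b' * a) :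
    IsEmpty (((Fin a → D.P₁) ⧸ LinearMap.range f) ≃ₗ[R]
      ((Fin a' → D.P₁) ⧸ LinearMap.range f')) := by
  refine ⟨fun E => ?_⟩
  have h := (E.congrLeft D.Simple₁ K).finrank_eq
  rw [finrank_coker_hom_simple₁, finrank_coker_hom_simple₁] at h
  subst h
  have := D.finiteDimensional_quotient (LinearMap.range f)
  have := projective_pi_idemIdeal D.idem₂ (Fin b)
  have := projective_pi_idemIdeal D.idem₂ (Fin b')
  let X := (Fin a → D.P₁) ⧸ LinearMap.range f
  have := finiteDimensional_pi_hom (K := K) (N := X) D.idem₁ (Fin a)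
  have h₁ := finrank_hom_coker (K := K) (N := X) f hff.exists_factor
  have h₂ := finrank_hom_coker (K := K) (N := X) f' hf'f.exists_factor
  have h₃ := (E.congrLeft X K).finrank_eq
  rw [finrank_pi_hom D.idem₂] at h₁ h₂
  have hpos := (D.exists_extension hba f hff).1
  have hbb : b * Module.finrank K (idemPart K D.e₂ X) =
      b' * Module.finrank K (idemPart K D.e₂ X) := by omega
  have := Nat.eq_of_mul_eq_mul_right hpos hbb
  subst this
  exact lt_irrefl _ hs

theorem exists_supportTauTilting {a b : ℕ} (h : D.IsRigidType a b) :
    ∃ (a' b' : ℕ) (M : ModuleCat.{0} R), D.IsRigidType a' b' ∧ b * a' < b' * a ∧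
      IsSupportTauTiltingCat R M ∧ IsBasicModuleCat R M ∧
      Module.finrank K (M →ₗ[R] D.Simple₁) = a + a' := by
  obtain ⟨hba, f, hff, hX⟩ := h
  obtain ⟨a', b', f', hff', hf'f, hf'f', hs, hba', hY⟩ :=
    D.exists_isIndecModule_extension hba f hff
  have hXY := D.isEmpty_equiv_coker hba hff hf'f hs
  have := projective_pi_idemIdeal D.idem₂ (Fin b)
  have := projective_pi_idemIdeal D.idem₂ (Fin b')
  have := projective_pi_idemIdeal D.idem₁ (Fin a)
  have := projective_pi_idemIdeal D.idem₁ (Fin a')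
  have := finite_idemIdeal D.idem₁
  have := finite_idemIdeal D.idem₂
  have hM := hasIndecClassCount_prod hX hY hXY
  refine ⟨a', b', _, ⟨hba', f', hf'f', hY⟩, hs,
    ⟨isTauRigidCat_prod hff hff' hf'f hf'f', ModuleCat.of R PUnit, 2, 0, 2,
      inferInstanceAs (Module.Finite R PUnit), inferInstanceAs (Module.Projective R PUnit),
      fun t => LinearMap.ext fun x => ?_, hM.1, hasIndecClassCount_zero R,
      D.hasIndecClassCount_self, rfl⟩, hM.2, ?_⟩
  · change t (0 : PUnit) = 0
    exact map_zero t
  · refine (LinearMap.coprodEquiv K (R := R) (M₃ := D.Simple₁)).symm.finrank_eq.trans ?_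
    have h₁ := D.finrank_coker_hom_simple₁ f
    have h₂ := D.finrank_coker_hom_simple₁ f'
    have : FiniteDimensional K (((Fin a → D.P₁) ⧸ LinearMap.range f) →ₗ[R] D.Simple₁) :=
      Module.finite_of_finrank_pos (by omega)
    have : FiniteDimensional K (((Fin a' → D.P₁) ⧸ LinearMap.range f') →ₗ[R] D.Simple₁) :=
      Module.finite_of_finrank_pos (by omega)
    rw [Module.finrank_prod, h₁, h₂]

theorem infinite_supportTauTilting (D : TwoArrowData K R) (n : ℕ) (L : Fin n → ModuleCat.{0} R) :
    ∃ M : ModuleCat.{0} R, (IsSupportTauTiltingCat R M ∧ IsBasicModuleCat R M) ∧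
      ∀ i, IsEmpty (M ≃ₗ[R] L i) := by
  by_contra! hcon
  let B := ∑ i, Module.finrank K (L i →ₗ[R] D.Simple₁)
  have hstep : ∀ a b, D.IsRigidType a b →
      a ≤ B ∧ ∃ a' b', D.IsRigidType a' b' ∧ b * a' < b' * a := by
    intro a b h
    obtain ⟨a', b', M, h', hs, h₁, h₂, hdim⟩ := D.exists_supportTauTilting h
    obtain ⟨i, ⟨E⟩⟩ := hcon M ⟨h₁, h₂⟩
    have hE := (E.congrLeft D.Simple₁ K).finrank_eq
    have hle : Module.finrank K (L i →ₗ[R] D.Simple₁) ≤ B :=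
      Finset.single_le_sum (f := fun i => Module.finrank K (L i →ₗ[R] D.Simple₁))
        (fun _ _ => Nat.zero_le _) (Finset.mem_univ i)
    exact ⟨by omega, a', b', h', hs⟩
  let S : Set (ℕ × ℕ) := {p | D.IsRigidType p.1 p.2}
  have hS : S.Finite := by
    refine ((Set.finite_Iic B).prod (Set.finite_Iic B)).subset fun p hp => ?_
    have h₁ := (hstep _ _ hp).1
    exact ⟨h₁, hp.1.le.trans h₁⟩
  obtain ⟨p, hp, hmax⟩ := Set.exists_max_image S (fun p => (p.2 : ℚ) / p.1) hS
    ⟨(1, 0), D.isRigidType_one_zero⟩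
  obtain ⟨-, a', b', h', hs⟩ := hstep _ _ hp
  have hle := hmax (a', b') h'
  have hp₁ : (0 : ℚ) < p.1 := by exact_mod_cast (Nat.zero_le _).trans_lt hp.1
  have ha' : (0 : ℚ) < a' := by exact_mod_cast (Nat.zero_le _).trans_lt h'.1
  rw [div_le_div_iff₀ ha' hp₁] at hle
  exact absurd (by exact_mod_cast hle) hs.not_ge

end TwoArrowData
/-! ### Representation-finite algebras are τ-tilting finite -/

theorem isTauTiltingFinite_of_isRepFinite {Λ : Type} [Ring Λ] [IsNoetherianRing Λᵐᵒᵖ]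
    (h : IsRepFinite Λ) : IsTauTiltingFinite Λ := by
  obtain ⟨n, L, hL⟩ := h
  obtain ⟨N, ⟨e⟩⟩ := Finite.exists_equiv_fin (Set (Fin n))
  refine ⟨N, fun i => ModuleCat.of Λᵐᵒᵖ (∀ s : e.symm i, L s), ?_⟩
  rintro M ⟨⟨⟨hfin, -⟩, -⟩, k, S, hinternal, hind, hne⟩
  have hM : IsNoetherian Λᵐᵒᵖ M := isNoetherian_of_isNoetherianRing_of_finite _ _
  choose j hj using fun i => hL (ModuleCat.of Λᵐᵒᵖ (S i))
    (inferInstanceAs (Module.Finite Λᵐᵒᵖ (S i))) (hind i)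
  let E : ∀ i, S i ≃ₗ[Λᵐᵒᵖ] L (j i) := fun i => (hj i).some
  have hinj : Function.Injective j := by
    intro i i' hii
    by_contra hcon
    have : Nonempty (L (j i) ≃ₗ[Λᵐᵒᵖ] L (j i')) := hii ▸ ⟨LinearEquiv.refl _ _⟩
    exact (hne i i' hcon).false ((E i).trans (this.some.trans (E i').symm))
  refine ⟨e (Set.range j), ⟨?_⟩⟩
  have F : M ≃ₗ[Λᵐᵒᵖ] (∀ s : Set.range j, L s) :=
    ((LinearEquiv.ofBijective (DirectSum.coeLinearMap S) hinternal).symm.trans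
      (DirectSum.linearEquivFunOnFintype Λᵐᵒᵖ (Fin k) fun i => S i)).trans
      ((LinearEquiv.piCongrRight E).trans
        (LinearEquiv.piCongrLeft Λᵐᵒᵖ (fun s : Set.range j => L s) (Equiv.ofInjective j hinj)))
  change M ≃ₗ[Λᵐᵒᵖ] (∀ s : (e.symm (e (Set.range j)) : Set (Fin n)), L s)
  rw [e.symm_apply_apply]
  exact F
/-! ### Algebras presented by a two-point quiver without loops -/

section Presentation

variable {K : Type} [Field K] {m n : ℕ} {Λ : Type} [Ring Λ] [Algebra K Λ]
  (π : PathAlgebra K 0 0 m n →ₐ[K] Λ)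

/-- The image of a vertex idempotent in a presented algebra. -/
def vertexImage (i : Fin 2) : Λ := π (RingQuot.mkAlgHom K _ (vtx K i))

/-- The image of an arrow in a presented algebra. -/
def arrowImage (a : QArrow 0 0 m n) : Λ := π (pathArrow K a)

theorem QTgt_ne_QSrc (a : QArrow 0 0 m n) : QTgt 0 0 m n a ≠ QSrc 0 0 m n a := by
  rcases a with (a | a) | (a | a)
  · exact a.elim0
  · exact a.elim0
  · simp [QTgt, QSrc]
  · simp [QTgt, QSrc]

theorem map_mkAlgHom_eq {x y : FreeAlgebra K (TPGen (QArrow 0 0 m n))}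
    (h : QuivRel K _ (QSrc 0 0 m n) (QTgt 0 0 m n) ∅ x y) :
    π (RingQuot.mkAlgHom K _ x) = π (RingQuot.mkAlgHom K _ y) :=
  congrArg π (RingQuot.mkAlgHom_rel K h)

theorem vertexImage_mul_self (i : Fin 2) :
    vertexImage π i * vertexImage π i = vertexImage π i := by
  simpa [vertexImage] using map_mkAlgHom_eq π (QuivRel.idem i)

theorem vertexImage_mul {i j : Fin 2} (h : i ≠ j) :
    vertexImage π i * vertexImage π j = 0 := by
  simpa [vertexImage] using map_mkAlgHom_eq π (QuivRel.orth i j h)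

theorem vertexImage_add : vertexImage π 0 + vertexImage π 1 = 1 := by
  simpa [vertexImage] using map_mkAlgHom_eq π QuivRel.vsum

theorem vertexImage_mul_arrowImage (a : QArrow 0 0 m n) :
    vertexImage π (QSrc 0 0 m n a) * arrowImage π a = arrowImage π a := by
  simpa [vertexImage, arrowImage, pathArrow] using map_mkAlgHom_eq π (QuivRel.src a)

theorem arrowImage_mul_vertexImage (a : QArrow 0 0 m n) :
    arrowImage π a * vertexImage π (QTgt 0 0 m n a) = arrowImage π a := by
  simpa [vertexImage, arrowImage, pathArrow] using map_mkAlgHom_eq π (QuivRel.tgt a)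

theorem vertexImage_mul_arrowImage_of_ne {i : Fin 2} {a : QArrow 0 0 m n}
    (h : i ≠ QSrc 0 0 m n a) : vertexImage π i * arrowImage π a = 0 := by
  rw [← vertexImage_mul_arrowImage, ← mul_assoc, vertexImage_mul π h, zero_mul]

theorem arrowImage_mul_vertexImage_of_ne {i : Fin 2} {a : QArrow 0 0 m n}
    (h : i ≠ QTgt 0 0 m n a) : arrowImage π a * vertexImage π i = 0 := by
  rw [← arrowImage_mul_vertexImage, mul_assoc, vertexImage_mul π h.symm, mul_zero]

variable {π}

theorem presented_induction (hπ : Function.Surjective π) {p : Λ → Prop}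
    (algebraMap : ∀ k : K, p (algebraMap K Λ k)) (vertex : ∀ i, p (vertexImage π i))
    (arrow : ∀ a, p (arrowImage π a)) (add : ∀ x y, p x → p y → p (x + y))
    (mul : ∀ x y, p x → p y → p (x * y)) (x : Λ) : p x := by
  obtain ⟨y, rfl⟩ := hπ x
  obtain ⟨z, rfl⟩ := RingQuot.mkAlgHom_surjective K _ y
  induction z using FreeAlgebra.induction with
  | grade0 k => simpa using algebraMap k
  | grade1 g =>
    cases g with
    | v i => exact vertex i
    | ar a => exact arrow a
  | mul a b ha hb => simpa using mul _ _ ha hb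
  | add a b ha hb => simpa using add _ _ ha hb

theorem exists_algHom_of_surjective {A B C : Type} [Ring A] [Ring B] [Ring C] [Algebra K A]
    [Algebra K B] [Algebra K C] {f : A →ₐ[K] B} (hf : Function.Surjective f) (g : A →ₐ[K] C)
    (h : ∀ x, f x = 0 → g x = 0) : ∃ φ : B →ₐ[K] C, ∀ x, φ (f x) = g x := by
  let φ : B →+* C := (f : A →+* B).liftOfSurjective hf ⟨(g : A →+* C), fun x hx => h x hx⟩
  have hφ : ∀ x, φ (f x) = g x := fun x =>
    RingHom.liftOfRightInverse_comp_apply (f : A →+* B) _ _ ⟨(g : A →+* C), fun x hx => h x hx⟩ x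
  refine ⟨{ φ with commutes' := fun k => ?_ }, hφ⟩
  have := hφ (algebraMap K A k)
  simpa using this

theorem exists_algHom (hπ : IsAdmissiblePresentation K Λ π) {A : Type} [Ring A] [Algebra K A]
    (ve : Fin 2 → A) (ar : QArrow 0 0 m n → A) (idem : ∀ i, ve i * ve i = ve i)
    (orth : ∀ i j, i ≠ j → ve i * ve j = 0) (sum : ve 0 + ve 1 = 1)
    (src : ∀ a, ve (QSrc 0 0 m n a) * ar a = ar a) (tgt : ∀ a, ar a * ve (QTgt 0 0 m n a) = ar a)
    (mul : ∀ a b, ar a * ar b = 0) :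
    ∃ φ : Λ →ₐ[K] A, (∀ i, φ (vertexImage π i) = ve i) ∧ ∀ a, φ (arrowImage π a) = ar a := by
  let f : FreeAlgebra K (TPGen (QArrow 0 0 m n)) →ₐ[K] A :=
    FreeAlgebra.lift K fun g => TPGen.rec ve ar g
  have hv : ∀ i, f (vtx K i) = ve i := fun i => FreeAlgebra.lift_ι_apply _ _
  have ha : ∀ a, f (arr K a) = ar a := fun a => FreeAlgebra.lift_ι_apply _ _
  let g : PathAlgebra K 0 0 m n →ₐ[K] A := RingQuot.liftAlgHom K ⟨f, fun x y h => by
    cases h with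
    | idem i => simpa [hv] using idem i
    | orth i j h => simpa [hv] using orth i j h
    | vsum => simpa [hv] using sum
    | src a => simpa [hv, ha] using src a
    | tgt a => simpa [hv, ha] using tgt a
    | rel p hp => exact hp.elim⟩
  have hg : ∀ x, g (RingQuot.mkAlgHom K _ x) = f x := fun x =>
    RingQuot.liftAlgHom_mkAlgHom_apply K f _ x
  have hker : ∀ x, π x = 0 → g x = 0 := fun x hx => by
    suffices h : twoSidedSpan K (PathAlgebra K 0 0 m n) (NProd (Set.range (pathArrow K)) 2) ≤
        LinearMap.ker g.toLinearMap from h (hπ.2.1 x hx)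
    refine Submodule.span_le.mpr ?_
    rintro x ⟨p, s, q, ⟨l, hl, hls, rfl⟩, rfl⟩
    obtain ⟨a, b, rfl⟩ := List.length_eq_two.mp hl
    obtain ⟨a, rfl⟩ := hls a (by simp)
    obtain ⟨b, rfl⟩ := hls b (by simp)
    simp only [SetLike.mem_coe, LinearMap.mem_ker, AlgHom.toLinearMap_apply, List.prod_cons,
      List.prod_nil, mul_one, map_mul, pathArrow, hg, ha, mul, mul_zero, zero_mul]
  obtain ⟨φ, hφ⟩ := exists_algHom_of_surjective hπ.1 g hker
  exact ⟨φ, fun i => by rw [vertexImage, hφ, hg, hv], fun a => by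
    rw [arrowImage, pathArrow, hφ, hg, ha]⟩

theorem exists_twoArrow_matrix (hπ : IsAdmissiblePresentation K Λ π) {v w : Fin 2} (hvw : v ≠ w)
    (T : Fin 2 → QArrow 0 0 m n → K) :
    ∃ φ : Λ →ₐ[K] Matrix (Fin 3) (Fin 3) K,
      φ (vertexImage π v) = !![1, 0, 0; 0, 0, 0; 0, 0, 0] ∧
      φ (vertexImage π w) = !![0, 0, 0; 0, 1, 0; 0, 0, 1] ∧
      (∀ a, QSrc 0 0 m n a = v → φ (arrowImage π a) = !![0, T 0 a, T 1 a; 0, 0, 0; 0, 0, 0]) ∧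
      (∀ a, QSrc 0 0 m n a ≠ v → φ (arrowImage π a) = 0) ∧
      ∀ x, φ x 1 0 = 0 ∧ φ x 2 0 = 0 ∧ φ x 1 2 = 0 ∧ φ x 2 1 = 0 ∧ φ x 1 1 = φ x 2 2 := by
  have key : ∀ i, i ≠ v ↔ i = w := by intro i; omega
  obtain ⟨φ, hv, ha⟩ := exists_algHom hπ
    (fun i => if i = v then !![1, 0, 0; 0, 0, 0; 0, 0, 0] else !![0, 0, 0; 0, 1, 0; 0, 0, 1])
    (fun a => if QSrc 0 0 m n a = v then !![0, T 0 a, T 1 a; 0, 0, 0; 0, 0, 0] else 0)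
    (fun i => by
      split_ifs <;> ext i j <;> fin_cases i <;> fin_cases j <;>
        simp [Matrix.mul_apply, Fin.sum_univ_three])
    (fun i j hij => by
      split_ifs <;> first | omega | ext i j <;> fin_cases i <;> fin_cases j <;>
        simp [Matrix.mul_apply, Fin.sum_univ_three])
    (by
      split_ifs <;> first | omega | ext i j <;> fin_cases i <;> fin_cases j <;>
        simp)
    (fun a => by
      split_ifs <;> ext i j <;> fin_cases i <;> fin_cases j <;>
        simp [Matrix.mul_apply, Fin.sum_univ_three])
    (fun a => by
      have := QTgt_ne_QSrc a
      split_ifs <;> first | omega | ext i j <;> fin_cases i <;> fin_cases j <;>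
        simp [Matrix.mul_apply, Fin.sum_univ_three])
    (fun a b => by
      split_ifs <;> ext i j <;> fin_cases i <;> fin_cases j <;>
        simp [Matrix.mul_apply, Fin.sum_univ_three])
  refine ⟨φ, by simp [hv], by simp [hv, hvw.symm], fun a h => by simp [ha, h],
    fun a h => by simp [ha, h], ?_⟩
  intro x
  induction x using presented_induction hπ.1 with
  | algebraMap k => simp [Matrix.algebraMap_matrix_apply]
  | vertex i =>
    rw [hv]
    split_ifs <;> simp
  | arrow a =>
    rw [ha]
    split_ifs <;> simp
  | add x y hx hy => simp [*]
  | mul x y hx hy => simp [Matrix.mul_apply, Fin.sum_univ_three, *]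

variable (π) in
/-- The span of the arrows in a presented algebra. -/
def arrowSpan : Submodule K Λ := Submodule.span K (Set.range (arrowImage π))

theorem arrowSpan_pow (hπ : IsAdmissiblePresentation K Λ π) : ∃ N, arrowSpan π ^ N = ⊥ := by
  obtain ⟨N, -, hN⟩ := hπ.2.2
  refine ⟨N, ?_⟩
  rw [arrowSpan, Submodule.span_pow, Submodule.span_eq_bot]
  intro x hx
  obtain ⟨f, rfl⟩ := Set.mem_pow.mp hx
  choose g hg using fun i => (f i).2
  have := hN (List.ofFn fun i => pathArrow K (g i)).prod
    ⟨_, List.length_ofFn, fun y hy => by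
      obtain ⟨i, rfl⟩ := (List.mem_ofFn' _ _).mp hy
      exact ⟨_, rfl⟩, rfl⟩
  rw [map_list_prod, List.map_ofFn] at this
  rw [← this]
  congr 2
  funext i
  exact (hg i).symm

theorem top_mul_arrowIdeal_le (hπ : Function.Surjective π) :
    (⊤ : Submodule K Λ) * (arrowSpan π * ⊤) ≤ arrowSpan π * ⊤ := by
  rw [Submodule.mul_le]
  intro x _
  induction x using presented_induction hπ with
  | algebraMap k =>
    intro y hy
    rw [← Algebra.smul_def]
    exact Submodule.smul_mem _ _ hy
  | vertex i =>
    intro y hy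
    induction hy using Submodule.mul_induction_on' with
    | mem_mul_mem a ha b hb =>
      rw [← mul_assoc]
      refine Submodule.mul_mem_mul ?_ hb
      induction ha using Submodule.span_induction with
      | mem x h =>
        obtain ⟨a, rfl⟩ := h
        by_cases hi : i = QSrc 0 0 m n a
        · rw [hi, vertexImage_mul_arrowImage]
          exact Submodule.subset_span ⟨a, rfl⟩
        · rw [vertexImage_mul_arrowImage_of_ne π hi]
          exact zero_mem _
      | zero => rw [mul_zero]; exact zero_mem _
      | add x y _ _ hx hy => rw [mul_add]; exact add_mem hx hy
      | smul k x _ hx => rw [mul_smul_comm]; exact Submodule.smul_mem _ _ hx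
    | add x _ y _ hx hy => rw [mul_add]; exact add_mem hx hy
  | arrow a =>
    intro y _
    exact Submodule.mul_mem_mul (Submodule.subset_span ⟨a, rfl⟩) Submodule.mem_top
  | add x y hx hy =>
    intro z hz
    rw [add_mul]
    exact add_mem (hx trivial z hz) (hy trivial z hz)
  | mul x y hx hy =>
    intro z hz
    rw [mul_assoc]
    exact hx trivial _ (hy trivial z hz)

theorem isNilpotent_of_mem_arrowIdeal (hπ : IsAdmissiblePresentation K Λ π) {x : Λ}
    (hx : x ∈ arrowSpan π * ⊤) : IsNilpotent x := by
  obtain ⟨N, hN⟩ := arrowSpan_pow hπ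
  have h : ∀ k, x ^ k ∈ arrowSpan π ^ k * ⊤ := by
    intro k
    induction k with
    | zero => rw [pow_zero, Submodule.one_mul]; exact Submodule.mem_top
    | succ k ih =>
      have := Submodule.mul_mem_mul ih hx
      rw [← pow_succ, mul_assoc] at this
      refine (mul_le_mul_right (top_mul_arrowIdeal_le hπ.1) _ : _ ≤ _) this |> fun h => ?_
      rwa [← mul_assoc, ← pow_succ] at h
  have := h N
  rw [hN, Submodule.bot_mul, Submodule.mem_bot] at this
  exact ⟨N, this⟩

end Presentation
theorem exists_twoArrowData {K : Type} [Field K] {m n : ℕ} {Λ : Type} [Ring Λ] [Algebra K Λ]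
    {π : PathAlgebra K 0 0 m n →ₐ[K] Λ} (hπ : IsAdmissiblePresentation K Λ π)
    (a : Fin 2 → QArrow 0 0 m n) (ha : Function.Injective a)
    (hsrc : QSrc 0 0 m n (a 0) = QSrc 0 0 m n (a 1)) : Nonempty (TwoArrowData K Λᵐᵒᵖ) := by
  classical
  obtain ⟨v, hv⟩ : ∃ v, ∀ l, QSrc 0 0 m n (a l) = v := ⟨_, Fin.forall_fin_two.mpr ⟨rfl, hsrc.symm⟩⟩
  obtain ⟨w, hvw⟩ : ∃ w, v ≠ w := (exists_ne v).imp fun _ h => h.symm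
  have hw : ∀ l, QTgt 0 0 m n (a l) = w := fun l => by
    have := QTgt_ne_QSrc (a l)
    have := hv l
    omega
  have hall : ∀ i, i = v ∨ i = w := by omega
  have hsum : vertexImage π v + vertexImage π w = 1 := by
    rcases hall 0 with h | h
    · obtain rfl : w = 1 := by omega
      rw [← h, vertexImage_add]
    · obtain rfl : v = 1 := by omega
      rw [← h, add_comm, vertexImage_add]
  obtain ⟨φ, hφv, hφw, hφa, hφa', hφ⟩ :=
    exists_twoArrow_matrix hπ hvw fun l b => if b = a l then 1 else 0
  let entry (i j : Fin 3) : Λ →ₗ[K] K := Matrix.entryLinearMap K K i j ∘ₗ φ.toLinearMap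
  let ρ : Λᵐᵒᵖ →ₗ[K] Λ := (MulOpposite.opLinearEquiv K).symm.toLinearMap
  have hφ0 : ∀ x y, φ (x * y) 0 0 = φ x 0 0 * φ y 0 0 := fun x y => by
    simp [Matrix.mul_apply, Fin.sum_univ_three, hφ]
  have hφ1 : ∀ x y, φ (x * y) 1 1 = φ x 1 1 * φ y 1 1 := fun x y => by
    simp [Matrix.mul_apply, Fin.sum_univ_three, hφ]
  have hmem : ∀ x, x - (φ x 0 0 • vertexImage π v + φ x 1 1 • vertexImage π w) ∈
      arrowSpan π * ⊤ := by
    intro x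
    induction x using presented_induction hπ.1 with
    | algebraMap k =>
      simp [← smul_add, hsum, Algebra.algebraMap_eq_smul_one]
    | vertex i =>
      rcases hall i with rfl | rfl
      · simp [hφv]
      · simp [hφw]
    | arrow b =>
      have : φ (arrowImage π b) 0 0 = 0 ∧ φ (arrowImage π b) 1 1 = 0 := by
        by_cases h : QSrc 0 0 m n b = v
        · simp [hφa b h]
        · simp [hφa' b h]
      rw [this.1, this.2, zero_smul, zero_smul, add_zero, sub_zero, ← mul_one (arrowImage π b)]
      exact Submodule.mul_mem_mul (Submodule.subset_span ⟨b, rfl⟩) Submodule.mem_top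
    | add x y hx hy =>
      convert! add_mem hx hy using 1
      simp only [map_add, Matrix.add_apply, add_smul]
      abel
    | mul x y hx hy =>
      have h₁ := top_mul_arrowIdeal_le hπ.1 (Submodule.mul_mem_mul (Submodule.mem_top (x := x)) hy)
      have h₂ := Submodule.mul_mem_mul hx
        (Submodule.mem_top (x := φ y 0 0 • vertexImage π v + φ y 1 1 • vertexImage π w))
      rw [mul_assoc] at h₂
      have h₃ := add_mem h₁ (mul_le_mul_right (le_top : (⊤ * ⊤ : Submodule K Λ) ≤ ⊤) _ h₂)
      convert! h₃ using 1
      rw [hφ0, hφ1, mul_sub, sub_mul, sub_add_sub_cancel]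
      congr 1
      simp [add_mul, mul_add, smul_smul, mul_comm, vertexImage_mul_self, vertexImage_mul π hvw,
        vertexImage_mul π hvw.symm]
  exact ⟨{
    e₁ := .op (vertexImage π v)
    e₂ := .op (vertexImage π w)
    χ₁ := entry 0 0 ∘ₗ ρ
    χ₂ := entry 1 1 ∘ₗ ρ
    c := fun l => entry 0 l.succ ∘ₗ ρ
    idem₁ := by rw [← MulOpposite.op_mul, vertexImage_mul_self]
    idem₂ := by rw [← MulOpposite.op_mul, vertexImage_mul_self]
    orth₁₂ := by rw [← MulOpposite.op_mul, vertexImage_mul π hvw.symm, MulOpposite.op_zero]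
    orth₂₁ := by rw [← MulOpposite.op_mul, vertexImage_mul π hvw, MulOpposite.op_zero]
    sum := by rw [← MulOpposite.op_add, hsum, MulOpposite.op_one]
    χ₁_mul := fun r s => by simp [entry, ρ, hφ, Matrix.mul_apply, Fin.sum_univ_three, mul_comm]
    χ₂_mul := fun r s => by simp [entry, ρ, hφ, Matrix.mul_apply, Fin.sum_univ_three, mul_comm]
    χ₁_e₁ := by simp [entry, ρ, hφv]
    χ₁_e₂ := by simp [entry, ρ, hφw]
    χ₂_e₁ := by simp [entry, ρ, hφv]
    χ₂_e₂ := by simp [entry, ρ, hφw]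
    nil := fun r h₁ h₂ => by
      have h := hmem r.unop
      have h₁ : φ r.unop 0 0 = 0 := h₁
      have h₂ : φ r.unop 1 1 = 0 := h₂
      rw [h₁, h₂, zero_smul, zero_smul, add_zero, sub_zero] at h
      obtain ⟨N, hN⟩ := isNilpotent_of_mem_arrowIdeal hπ h
      exact ⟨N, MulOpposite.unop_injective (by simpa using hN)⟩
    c_mul := fun l r s => by
      fin_cases l
      · simp [entry, ρ, hφ, Matrix.mul_apply, Fin.sum_univ_three]
        ring
      · have := fun x => (hφ x).2.2.2.2
        simp [entry, ρ, hφ, Matrix.mul_apply, Fin.sum_univ_three]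
        ring
    c_surj := fun y => by
      refine ⟨.op (∑ l, y l • arrowImage π (a l)), ?_, fun l => ?_⟩
      · rw [← MulOpposite.op_mul, ← MulOpposite.op_mul]
        congr 1
        have h₁ : ∀ l, vertexImage π v * arrowImage π (a l) = arrowImage π (a l) := fun l => by
          rw [← hv l, vertexImage_mul_arrowImage]
        have h₂ : ∀ l, arrowImage π (a l) * vertexImage π w = arrowImage π (a l) := fun l => by
          rw [← hw l, arrowImage_mul_vertexImage]
        simp [mul_add, add_mul, h₁, h₂]
      · have h01 : a 0 ≠ a 1 := fun h => absurd (ha h) (by decide)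
        fin_cases l <;> simp [entry, ρ, hφa _ (hv _), h01, h01.symm] }⟩
/-! ### Nakayama algebras with two simple modules -/

/-- Structure witnessing that an algebra is a quotient of the path algebra of the oriented cycle
with two vertices by an ideal containing a power of the sum `α` of the arrows. -/
structure CycleData (K R : Type) [Field K] [Ring R] [Algebra K R] where
  e : Fin 2 → R
  α : R
  idem : ∀ i, e i * e i = e i
  orth : ∀ i j, i ≠ j → e i * e j = 0
  sum : e 0 + e 1 = 1
  comm : ∀ i, α * e i = e (i + 1) * α
  split : ∀ t, ∃ (c : Fin 2 → K) (t' : R), t = c 0 • e 0 + c 1 • e 1 + α * t'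
  nil : IsNilpotent α

namespace CycleData

variable {K R : Type} [Field K] [Ring R] [Algebra K R] (D : CycleData K R)

theorem pow_comm (s : ℕ) (i : Fin 2) : ∃ j, D.α ^ s * D.e i = D.e j * D.α ^ s := by
  induction s generalizing i with
  | zero => exact ⟨i, by simp⟩
  | succ s ih =>
    obtain ⟨j, hj⟩ := ih (i + 1)
    exact ⟨j, by rw [pow_succ, mul_assoc, D.comm, ← mul_assoc, hj, mul_assoc]⟩

theorem split_idem (i : Fin 2) (t : R) :
    ∃ (c : K) (t' : R), t * D.e i = c • D.e i + D.α * (t' * D.e i) := by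
  obtain ⟨c, t', ht⟩ := D.split t
  refine ⟨c i, t', ?_⟩
  rw [ht, add_mul, add_mul, smul_mul_assoc, smul_mul_assoc, mul_assoc]
  fin_cases i
  · simp [D.idem, D.orth]
  · simp [D.idem, D.orth]

variable {M : Type} [AddCommGroup M] [Module R M] [Module K M] [IsScalarTower K R M]

theorem exists_eq_pow_mul {i : Fin 2} {l : ℕ} {x : M} (hx : D.e i • x = x)
    (hl : ∀ y : M, D.α ^ (l + 1) • y = 0) {r : R}
    (hr : ∀ (s : ℕ) (c : K), D.α ^ s • r • x = c • D.α ^ l • x → c = 0) :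
    ∃ t, r * D.e i = D.α ^ (l + 1) * (t * D.e i) := by
  suffices h : ∀ k ≤ l + 1, ∃ t, r * D.e i = D.α ^ k * (t * D.e i) from h _ le_rfl
  intro k hk
  induction k with
  | zero => exact ⟨r, by simp⟩
  | succ k ih =>
    obtain ⟨t, ht⟩ := ih (by omega)
    obtain ⟨c, t', ht'⟩ := D.split_idem i t
    have hc : c = 0 := by
      refine hr (l - k) c ?_
      have hrx : r • x = D.α ^ k • (c • x + D.α • (t' * D.e i) • x) := by
        conv_lhs => rw [← hx, ← mul_smul, ht, ht', mul_smul, add_smul, smul_assoc, hx, mul_smul]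
      rw [hrx, ← mul_smul, ← pow_add, show l - k + k = l by omega, smul_add, ← mul_smul (D.α ^ l),
        ← pow_succ, hl, add_zero, smul_algebra_smul_comm]
    refine ⟨t', ?_⟩
    rw [ht, ht', hc, zero_smul, zero_add, ← mul_assoc, pow_succ]

/-- A normal form of an indecomposable module: a generator in the image of an idempotent, and the
largest power of `α` acting nontrivially. -/
def IsGenerator (M : Type) [AddCommGroup M] [Module R M] (i : Fin 2) (l : ℕ) (x : M) : Prop :=
  D.e i • x = x ∧ D.α ^ l • x ≠ 0 ∧ (∀ y : M, D.α ^ (l + 1) • y = 0) ∧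
    Submodule.span R {x} = ⊤

theorem IsGenerator.smul_eq_zero_iff {D : CycleData K R} {i : Fin 2} {l : ℕ} {x : M}
    (h : D.IsGenerator M i l x) (r : R) :
    r • x = 0 ↔ ∃ t, r * D.e i = D.α ^ (l + 1) * t := by
  obtain ⟨hx, hne, hl, -⟩ := h
  constructor
  · intro hr
    obtain ⟨t, ht⟩ := D.exists_eq_pow_mul hx hl (r := r) fun s c hc => by
      rw [hr, smul_zero] at hc
      exact (smul_eq_zero.mp hc.symm).resolve_right hne
    exact ⟨_, ht⟩
  · rintro ⟨t, ht⟩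
    rw [← hx, ← mul_smul, ht, mul_smul, hl]

theorem IsGenerator.nonempty_equiv {D : CycleData K R} {M' : Type} [AddCommGroup M'] [Module R M']
    [Module K M'] [IsScalarTower K R M'] {i : Fin 2} {l : ℕ} {x : M} {x' : M'}
    (h : D.IsGenerator M i l x) (h' : D.IsGenerator M' i l x') : Nonempty (M ≃ₗ[R] M') := by
  have hs : ∀ {N : Type} [AddCommGroup N] [Module R N] {z : N}, D.IsGenerator N i l z →
      Function.Surjective (LinearMap.toSpanSingleton R N z) := fun h => by
    rw [← LinearMap.range_eq_top, LinearMap.range_toSpanSingleton, h.2.2.2]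
  have hk : LinearMap.ker (LinearMap.toSpanSingleton R M x) =
      LinearMap.ker (LinearMap.toSpanSingleton R M' x') := by
    ext r
    simp only [LinearMap.mem_ker, LinearMap.toSpanSingleton_apply, h.smul_eq_zero_iff,
      h'.smul_eq_zero_iff]
  exact ⟨(LinearMap.quotKerEquivOfSurjective _ (hs h)).symm ≪≫ₗ
    Submodule.quotEquivOfEq _ _ hk ≪≫ₗ LinearMap.quotKerEquivOfSurjective _ (hs h')⟩

theorem exists_dual {j : Fin 2} {y : M} (hy : D.e j • y = y) (h0 : y ≠ 0) :
    ∃ ψ : M →ₗ[K] K, ψ y = 1 ∧ (∀ z, ψ (D.e j • z) = ψ z) ∧ ∀ i ≠ j, ∀ z, ψ (D.e i • z) = 0 := by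
  obtain ⟨ψ, hψ⟩ : ∃ ψ : Module.Dual K M, ψ y ≠ 0 := by
    by_contra! h
    exact h0 ((Module.forall_dual_apply_eq_zero_iff K y).mp h)
  refine ⟨(ψ y)⁻¹ • ψ ∘ₗ Module.toModuleEnd K (S := R) M (D.e j), ?_, ?_, ?_⟩
  · simp [hy, hψ]
  · intro z
    simp [← mul_smul, D.idem]
  · intro i hi z
    simp [← mul_smul, D.orth _ _ hi.symm]

theorem exists_isGenerator_of_dual {j i : Fin 2} {l : ℕ} {x : M} {ψ : M →ₗ[K] K}
    (hM : IsIndecModule R M) (hx : D.e i • x = x)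
    (hl : ∀ y : M, D.α ^ (l + 1) • y = 0) (h1 : ψ (D.α ^ l • x) = 1)
    (hj : ∀ z, ψ (D.e j • z) = ψ z) (hj' : ∀ i ≠ j, ∀ z, ψ (D.e i • z) = 0) :
    D.IsGenerator M i l x := by
  have hne : D.α ^ l • x ≠ 0 := fun h => by simp [h] at h1
  refine ⟨hx, hne, hl, ?_⟩
  let W : Submodule R M :=
    { carrier := {y | ∀ r : R, ψ (r • y) = 0}
      add_mem' := fun ha hb r => by rw [smul_add, map_add, ha, hb, add_zero]
      zero_mem' := fun r => by simp
      smul_mem' := fun s y hy r => by rw [← mul_smul]; exact hy _ }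
  have hW : ∀ z : M, (∀ s : ℕ, ψ (D.α ^ s • z) = 0) → z ∈ W := by
    intro z hz r
    obtain ⟨N, hN⟩ := D.nil
    have key : ∀ k s, N ≤ s + k → ∀ r : R, ψ (D.α ^ s • r • z) = 0 := by
      intro k
      induction k with
      | zero => intro s hs r; rw [pow_eq_zero_of_le (by simpa using hs) hN, zero_smul, map_zero]
      | succ k ih =>
        intro s hs r
        have he : ∀ i, ψ (D.α ^ s • D.e i • z) = 0 := by
          intro i
          obtain ⟨i', hi'⟩ := D.pow_comm s i
          rw [← mul_smul, hi', mul_smul]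
          by_cases h : i' = j
          · rw [h, hj, hz]
          · exact hj' _ h _
        obtain ⟨c, t', ht⟩ := D.split r
        have := ih (s + 1) (by omega) t'
        rw [pow_succ, mul_smul] at this
        rw [ht, add_smul, add_smul, smul_assoc, smul_assoc, smul_add, smul_add,
          smul_algebra_smul_comm, smul_algebra_smul_comm, map_add, map_add, ψ.map_smul, ψ.map_smul,
          he, he, mul_smul, this]
        simp
    simpa using key N 0 (by omega) r
  have hdisj : Disjoint (Submodule.span R {x}) W := by
    rw [Submodule.disjoint_def]
    intro y hy hyW
    obtain ⟨r, rfl⟩ := Submodule.mem_span_singleton.mp hy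
    obtain ⟨t, ht⟩ := D.exists_eq_pow_mul hx hl (r := r) fun s c hc => by
      have := hyW (D.α ^ s)
      rwa [hc, map_smul, h1, smul_eq_mul, mul_one] at this
    rw [← hx, ← mul_smul, ht, mul_smul, hl]
  have hcod : Codisjoint (Submodule.span R {x}) W := by
    rw [codisjoint_iff, eq_top_iff]
    intro y _
    have key : ∀ k ≤ l + 1, ∃ u ∈ Submodule.span R {x}, ∀ s, l < s + k →
        ψ (D.α ^ s • (y - u)) = 0 := by
      intro k hk
      induction k with
      | zero =>
        refine ⟨0, zero_mem _, fun s hs => ?_⟩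
        obtain ⟨s', rfl⟩ : ∃ s', s = s' + (l + 1) := ⟨s - (l + 1), by omega⟩
        rw [pow_add, mul_smul, hl, smul_zero, map_zero]
      | succ k ih =>
        obtain ⟨u, hu, h⟩ := ih (by omega)
        refine ⟨u + (ψ (D.α ^ (l - k) • (y - u)) • D.α ^ k) • x,
          add_mem hu (Submodule.smul_mem _ _ (Submodule.mem_span_singleton_self x)), ?_⟩
        intro s hs
        rw [← sub_sub, smul_sub, smul_assoc, smul_algebra_smul_comm, ← mul_smul, ← pow_add,
          map_sub, ψ.map_smul]
        rcases Nat.lt_or_ge l (s + k) with h' | h'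
        · obtain ⟨s', hs'⟩ : ∃ s', s + k = s' + (l + 1) := ⟨s + k - (l + 1), by omega⟩
          rw [h s h', hs', pow_add, mul_smul, hl]
          simp
        · rw [show s = l - k by omega, show l - k + k = l by omega, h1]
          simp
    obtain ⟨u, hu, h⟩ := key (l + 1) le_rfl
    have := Submodule.add_mem_sup hu (hW (y - u) fun s => h s (by omega))
    rwa [add_sub_cancel] at this
  rcases hM.2 _ _ ⟨hdisj, hcod⟩ with h | h
  · rw [Submodule.span_singleton_eq_bot] at h
    rw [h, smul_zero] at hne
    exact absurd rfl hne
  · rwa [h, codisjoint_bot] at hcod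

theorem exists_isGenerator {N : ℕ} (hN : D.α ^ N = 0) (hM : IsIndecModule R M) :
    ∃ (i : Fin 2) (l : Fin N) (x : M), D.IsGenerator M i l x := by
  classical
  have hex : ∃ k, ∀ y : M, D.α ^ k • y = 0 := ⟨N, fun y => by rw [hN, zero_smul]⟩
  obtain ⟨l, hl⟩ : ∃ l, Nat.find hex = l + 1 := by
    refine Nat.exists_eq_succ_of_ne_zero fun h => ?_
    obtain ⟨y, hy⟩ := @exists_ne M hM.1 0
    have := Nat.find_spec hex y
    rw [h, pow_zero, one_smul] at this
    exact hy this
  have hlN : l < N := by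
    have := Nat.find_min' hex (m := N) fun y => by rw [hN, zero_smul]
    omega
  have hl0 : ∀ y : M, D.α ^ (l + 1) • y = 0 := hl ▸ Nat.find_spec hex
  obtain ⟨y, hy⟩ : ∃ y : M, D.α ^ l • y ≠ 0 := by
    by_contra! h
    have := Nat.find_min' hex h
    omega
  obtain ⟨i, hi⟩ : ∃ i, D.α ^ l • D.e i • y ≠ 0 := by
    by_contra! h
    apply hy
    rw [← one_smul R y, ← D.sum, add_smul, smul_add, h, h, add_zero]
  have hx : D.e i • D.e i • y = D.e i • y := by rw [← mul_smul, D.idem]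
  obtain ⟨j, hj⟩ := D.pow_comm l i
  obtain ⟨ψ, h1, h2, h3⟩ := D.exists_dual (y := D.α ^ l • D.e i • y) (j := j)
    (by rw [← mul_smul (D.α ^ l), hj, ← mul_smul, ← mul_assoc, D.idem]) hi
  exact ⟨i, ⟨l, hlN⟩, D.e i • y, D.exists_isGenerator_of_dual hM hx hl0 h1 h2 h3⟩

theorem exists_indecomposables (D : CycleData K R) :
    ∃ (n : ℕ) (L : Fin n → ModuleCat.{0} R), ∀ M : ModuleCat.{0} R, IsIndecModule R M →
      ∃ i, Nonempty (M ≃ₗ[R] L i) := by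
  classical
  obtain ⟨N, hN⟩ := D.nil
  let P : Fin 2 × Fin N → ModuleCat.{0} R → Prop := fun p M => ∃ x : M, D.IsGenerator M p.1 p.2 x
  let L : Fin 2 × Fin N → ModuleCat.{0} R := fun p =>
    if h : ∃ M, P p M then h.choose else ModuleCat.of R PUnit
  let E := Fintype.equivFin (Fin 2 × Fin N)
  refine ⟨_, fun k => L (E.symm k), fun M hM => ?_⟩
  let _ : ∀ X : ModuleCat.{0} R, Module K X := fun X => Module.compHom X (algebraMap K R)
  have : ∀ X : ModuleCat.{0} R, IsScalarTower K R X := fun X => ⟨fun k r x => by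
    rw [Algebra.smul_def, mul_smul]; rfl⟩
  obtain ⟨i, l, x, hx⟩ := D.exists_isGenerator hN hM
  have h : ∃ M, P (i, l) M := ⟨M, x, hx⟩
  have hL : P (i, l) (L (i, l)) := by
    simp only [L, dif_pos h]
    exact h.choose_spec
  obtain ⟨x', hx'⟩ := hL
  refine ⟨E (i, l), ?_⟩
  beta_reduce
  rw [Equiv.symm_apply_apply]
  exact hx.nonempty_equiv hx'

end CycleData
instance (i j m n : ℕ) : Fintype (QArrow i j m n) :=
  inferInstanceAs (Fintype ((Fin i ⊕ Fin j) ⊕ (Fin m ⊕ Fin n)))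

section Cycle

variable {K : Type} [Field K] {m n : ℕ} {Λ : Type} [Ring Λ] [Algebra K Λ]
  (π : PathAlgebra K 0 0 m n →ₐ[K] Λ)

/-- The image of the sum of all arrows in a presented algebra. -/
def arrowSum : Λ := ∑ a, arrowImage π a

theorem vertexImage_mul_arrowSum (i : Fin 2) :
    vertexImage π i * arrowSum π = arrowSum π * vertexImage π (i + 1) := by
  rw [arrowSum, Finset.mul_sum, Finset.sum_mul]
  refine Finset.sum_congr rfl fun a _ => ?_
  have := QTgt_ne_QSrc a
  by_cases h : i = QSrc 0 0 m n a
  · obtain h' : i + 1 = QTgt 0 0 m n a := by omega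
    rw [h', h, vertexImage_mul_arrowImage, arrowImage_mul_vertexImage]
  · rw [vertexImage_mul_arrowImage_of_ne π h, arrowImage_mul_vertexImage_of_ne π (by omega)]

theorem vertexImage_QSrc_mul_arrowSum (hinj : Function.Injective (QSrc 0 0 m n))
    (a : QArrow 0 0 m n) :
    vertexImage π (QSrc 0 0 m n a) * arrowSum π = arrowImage π a := by
  rw [arrowSum, Finset.mul_sum, Finset.sum_eq_single a, vertexImage_mul_arrowImage]
  · exact fun b _ hb => vertexImage_mul_arrowImage_of_ne π fun h => hb (hinj h).symm
  · exact fun h => absurd (Finset.mem_univ a) h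

variable {π}

theorem exists_split_arrowSum (hπ : Function.Surjective π)
    (hinj : Function.Injective (QSrc 0 0 m n)) (x : Λ) :
    ∃ (c : Fin 2 → K) (y : Λ),
      x = c 0 • vertexImage π 0 + c 1 • vertexImage π 1 + y * arrowSum π := by
  induction x using presented_induction hπ with
  | algebraMap k =>
    exact ⟨fun _ => k, 0, by
      rw [← smul_add, vertexImage_add, zero_mul, add_zero, Algebra.algebraMap_eq_smul_one]⟩
  | vertex i => exact ⟨Pi.single i 1, 0, by fin_cases i <;> simp⟩
  | arrow a => exact ⟨0, vertexImage π (QSrc 0 0 m n a), by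
      simp [vertexImage_QSrc_mul_arrowSum π hinj]⟩
  | add x y hx hy =>
    obtain ⟨c, x', rfl⟩ := hx
    obtain ⟨d, y', rfl⟩ := hy
    refine ⟨c + d, x' + y', ?_⟩
    simp only [Pi.add_apply, add_smul, add_mul]
    abel
  | mul x y hx hy =>
    obtain ⟨c, x', rfl⟩ := hx
    obtain ⟨d, y', rfl⟩ := hy
    have h₀ : arrowSum π * vertexImage π 0 = vertexImage π 1 * arrowSum π :=
      (vertexImage_mul_arrowSum π 1).symm
    have h₁ : arrowSum π * vertexImage π 1 = vertexImage π 0 * arrowSum π :=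
      (vertexImage_mul_arrowSum π 0).symm
    refine ⟨c * d, (c 0 • vertexImage π 0 + c 1 • vertexImage π 1) * y' +
      x' * (d 0 • vertexImage π 1 + d 1 • vertexImage π 0 + arrowSum π * y'), ?_⟩
    have h : arrowSum π * (d 0 • vertexImage π 0 + d 1 • vertexImage π 1) =
        (d 0 • vertexImage π 1 + d 1 • vertexImage π 0) * arrowSum π := by
      simp [mul_add, add_mul, h₀, h₁]
    have hcd : (c 0 • vertexImage π 0 + c 1 • vertexImage π 1) *
        (d 0 • vertexImage π 0 + d 1 • vertexImage π 1) =
        (c * d) 0 • vertexImage π 0 + (c * d) 1 • vertexImage π 1 := by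
      simp [mul_add, add_mul, vertexImage_mul_self, vertexImage_mul, smul_smul, mul_comm]
    have expand : ∀ C D X Y A D' : Λ, A * D = D' * A →
        (C + X * A) * (D + Y * A) = C * D + (C * Y + X * (D' + A * Y)) * A := by
      intro C D X Y A D' h
      have : (C + X * A) * (D + Y * A) = C * D + C * Y * A + X * (A * D) + X * A * Y * A := by
        noncomm_ring
      rw [this, h]
      noncomm_ring
    rw [← hcd]
    exact expand _ _ _ _ _ _ h

theorem isNilpotent_arrowSum (hπ : IsAdmissiblePresentation K Λ π) :
    IsNilpotent (arrowSum π) := by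
  obtain ⟨N, hN⟩ := arrowSpan_pow hπ
  refine ⟨N, ?_⟩
  rw [← Submodule.mem_bot K, ← hN]
  exact Submodule.pow_mem_pow _
    (sum_mem fun a _ => Submodule.subset_span (Set.mem_range_self a)) _

theorem exists_cycleData (hπ : IsAdmissiblePresentation K Λ π)
    (hinj : Function.Injective (QSrc 0 0 m n)) : Nonempty (CycleData K Λᵐᵒᵖ) :=
  ⟨{
    e := fun i => .op (vertexImage π i)
    α := .op (arrowSum π)
    idem := fun i => by rw [← MulOpposite.op_mul, vertexImage_mul_self]
    orth := fun i j h => by rw [← MulOpposite.op_mul, vertexImage_mul π h.symm, MulOpposite.op_zero]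
    sum := by rw [← MulOpposite.op_add, vertexImage_add, MulOpposite.op_one]
    comm := fun i => by rw [← MulOpposite.op_mul, ← MulOpposite.op_mul, vertexImage_mul_arrowSum]
    split := fun t => by
      obtain ⟨c, y, h⟩ := exists_split_arrowSum hπ.1 hinj t.unop
      refine ⟨c, .op y, MulOpposite.unop_injective ?_⟩
      simpa using h
    nil := by
      obtain ⟨N, hN⟩ := isNilpotent_arrowSum hπ
      exact ⟨N, by rw [← MulOpposite.op_pow, hN, MulOpposite.op_zero]⟩ }⟩

end Cycle
/-- Corollary 3.6.  A two-point algebra without loops (i.e. a finite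
dimensional basic algebra presented by an admissible quotient of `KQ(0,0,m,n)`) is
τ-tilting finite if and only if it is representation-finite. -/
theorem two_point_no_loops_tau_tilting_finite_iff_rep_finite
    (K : Type) [Field K] [IsAlgClosed K] (m n : ℕ)
    (Λ : Type) [Ring Λ] [Algebra K Λ] [FiniteDimensional K Λ]
    (hbasic : IsBasicAlgebra Λ)
    (π : PathAlgebra K 0 0 m n →ₐ[K] Λ)
    (hπ : IsAdmissiblePresentation K Λ π) :
    IsTauTiltingFinite Λ ↔ IsRepFinite Λ := by
  have : IsNoetherianRing Λᵐᵒᵖ := isNoetherian_of_tower K inferInstance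
  refine ⟨fun ⟨k, L, hL⟩ => ?_, isTauTiltingFinite_of_isRepFinite⟩
  by_cases hinj : Function.Injective (QSrc 0 0 m n)
  · obtain ⟨D⟩ := exists_cycleData hπ hinj
    obtain ⟨r, L', hL'⟩ := D.exists_indecomposables
    exact ⟨r, L', fun M _ hM => hL' M hM⟩
  · simp only [Function.Injective, not_forall] at hinj
    obtain ⟨a, b, hab, hne⟩ := hinj
    obtain ⟨D⟩ := exists_twoArrowData hπ ![a, b] (by
      intro i j h
      fin_cases i <;> fin_cases j <;> simp_all) hab
    obtain ⟨M, hM, hM'⟩ := D.infinite_supportTauTilting k L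
    obtain ⟨i, ⟨f⟩⟩ := hL M hM
    exact ((hM' i).false f).elim

end TwoPoint
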